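/- Assume (F), (W) and (P2). Suppose ρ_L<ρ_R, f(ρ_L)≤f(ρ_R) and p(ρ_L+)<f(ρ_L)≤p(ρ_L−) (case (CN2)). Then there exist T>0 and two entropy weak solutions ρ¹, ρ² on [0,T) of the constrained Riemann problem with non-local constraint such that f(ρ¹(t,0−))=f(ρ¹(t,0+))=f(ρ_L) and f(ρ²(t,0−))=f(ρ²(t,0+))=p(ρ_L+) for a.e. t∈(0,T); in particular ρ¹ and ρ² do not coincide a.e. on (0,τ)×ℝ for any τ∈(0,T], so the problem admits more than one entropy weak solution. -/

import Mathlib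

open MeasureTheory Set Filter

namespace CRP

noncomputable section

/-- Smooth compactly supported test functions on `ℝ²`. -/
def TestFn (φ : ℝ × ℝ → ℝ) : Prop :=
  ContDiff ℝ (⊤ : ℕ∞) φ ∧ HasCompactSupport φ

/-- Partial derivative of a test function in the first (time) variable. -/
def pdT (φ : ℝ × ℝ → ℝ) (z : ℝ × ℝ) : ℝ := fderiv ℝ φ z (1, 0)

/-- Partial derivative of a test function in the second (space) variable. -/
def pdX (φ : ℝ × ℝ → ℝ) (z : ℝ × ℝ) : ℝ := fderiv ℝ φ z (0, 1)

/-- Assumption (F): `f : [0,R] → [0,∞)` is Lipschitz, `f 0 = 0 = f R`, and there is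
`ρb ∈ (0,R)` with `f' ρ * (ρb - ρ) > 0` for a.e. `ρ ∈ [0,R]`. -/
def AF (R ρb : ℝ) (f : ℝ → ℝ) : Prop :=
  0 < R ∧ (∃ L : NNReal, LipschitzOnWith L f (Icc 0 R)) ∧
    (∀ x ∈ Icc (0:ℝ) R, 0 ≤ f x) ∧ f 0 = 0 ∧ f R = 0 ∧ ρb ∈ Ioo 0 R ∧
    (∀ᵐ x ∂(volume.restrict (Icc (0:ℝ) R)), deriv f x * (ρb - x) > 0)

/-- Assumption (W): `w` is a nonnegative non-decreasing weight on `ℝ₋` with unit integral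
and support in `[-i_w, 0]`. -/
def AW (w : ℝ → ℝ) : Prop :=
  (∀ x ≤ (0:ℝ), 0 ≤ w x) ∧ MonotoneOn w (Iic 0) ∧
    (∫ x in Iic (0:ℝ), w x) = 1 ∧ ∃ iw : ℝ, 0 < iw ∧ ∀ x ≤ -iw, w x = 0

/-- Assumption (P2): `p : [0,R] → (0, fmax]` is non-increasing and piecewise constant
with finitely many jumps (equivalently, it has finitely many values). -/
def AP2 (R fmax : ℝ) (p : ℝ → ℝ) : Prop :=
  AntitoneOn p (Icc 0 R) ∧ (∀ ξ ∈ Icc (0:ℝ) R, p ξ ∈ Ioc 0 fmax) ∧ (p '' Icc 0 R).Finite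

/-- The left limit `p(ξ−)` of a non-increasing piecewise constant `p` on `[0,R]`,
with the convention `p(0−) = p 0`. -/
def pminus (p : ℝ → ℝ) (ξ : ℝ) : ℝ := if ξ ≤ 0 then p 0 else sInf (p '' Ico 0 ξ)

/-- The right limit `p(ξ+)` of a non-increasing piecewise constant `p` on `[0,R]`,
with the convention `p(R+) = p R`. -/
def pplus (R : ℝ) (p : ℝ → ℝ) (ξ : ℝ) : ℝ := if R ≤ ξ then p R else sSup (p '' Ioc ξ R)

/-- `γ` is the left measure-theoretic trace of `ρ` at `x = 0`. -/
def LeftTraceAt (ρ : ℝ → ℝ → ℝ) (γ : ℝ → ℝ) : Prop :=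
  ∀ φ : ℝ × ℝ → ℝ, TestFn φ →
    Tendsto (fun ε : ℝ => (1 / ε) * ∫ t in Ioi (0:ℝ), ∫ x in Ioo (-ε) (0:ℝ),
        |ρ t x - γ t| * φ (t, x)) (nhdsWithin 0 (Ioi 0)) (nhds 0)

/-- `γ` is the right measure-theoretic trace of `ρ` at `x = 0`. -/
def RightTraceAt (ρ : ℝ → ℝ → ℝ) (γ : ℝ → ℝ) : Prop :=
  ∀ φ : ℝ × ℝ → ℝ, TestFn φ →
    Tendsto (fun ε : ℝ => (1 / ε) * ∫ t in Ioi (0:ℝ), ∫ x in Ioo (0:ℝ) ε,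
        |ρ t x - γ t| * φ (t, x)) (nhdsWithin 0 (Ioi 0)) (nhds 0)

/-- The constrained entropy inequality (i), with constraint level `q`, initial datum `ρ0`,
tested on all nonnegative test functions. -/
def EntIneq (R fmax : ℝ) (f q ρ0 : ℝ → ℝ) (ρ : ℝ → ℝ → ℝ) : Prop :=
  ∀ φ : ℝ × ℝ → ℝ, TestFn φ → (∀ z, 0 ≤ φ z) → ∀ k ∈ Icc (0:ℝ) R,
    0 ≤ (∫ t in Ioi (0:ℝ), ∫ x : ℝ,
          (|ρ t x - k| * pdT φ (t, x) +
            Real.sign (ρ t x - k) * (f (ρ t x) - f k) * pdX φ (t, x))) +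
        2 * (∫ t in Ioi (0:ℝ), (1 - q t / fmax) * f k * φ (t, 0)) +
        ∫ x : ℝ, |ρ0 x - k| * φ (0, x)

/-- The constrained entropy inequality (i) on the time interval `[0,T)`: only test
functions supported in `(-∞,T) × ℝ` are used. -/
def EntIneqOn (R fmax T : ℝ) (f q ρ0 : ℝ → ℝ) (ρ : ℝ → ℝ → ℝ) : Prop :=
  ∀ φ : ℝ × ℝ → ℝ, TestFn φ → (∀ z, 0 ≤ φ z) →
    tsupport φ ⊆ Iio T ×ˢ (univ : Set ℝ) → ∀ k ∈ Icc (0:ℝ) R,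
    0 ≤ (∫ t in Ioi (0:ℝ), ∫ x : ℝ,
          (|ρ t x - k| * pdT φ (t, x) +
            Real.sign (ρ t x - k) * (f (ρ t x) - f k) * pdX φ (t, x))) +
        2 * (∫ t in Ioi (0:ℝ), (1 - q t / fmax) * f k * φ (t, 0)) +
        ∫ x : ℝ, |ρ0 x - k| * φ (0, x)

/-- Basic regularity required of solutions: measurability, values in `[0,R]`, and
continuity in time with values in `L¹loc` (on compact sets `[-r,r]`). -/
def RegSol (R : ℝ) (ρ : ℝ → ℝ → ℝ) : Prop :=
  Measurable (Function.uncurry ρ) ∧ (∀ t x, ρ t x ∈ Icc (0:ℝ) R) ∧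
    ∀ r : ℝ, 0 < r → ∀ s : ℝ, 0 ≤ s →
      Tendsto (fun t => ∫ x in Icc (-r) r, |ρ t x - ρ s x|) (nhdsWithin s (Ici 0)) (nhds 0)

/-- `ρ`, with traces `γm`, `γp` at `x = 0`, satisfies the constrained entropy
inequalities with constraint level `q : (0,∞) → [0,fmax]` and initial datum `ρ0`. -/
def CEI (R fmax : ℝ) (f q ρ0 : ℝ → ℝ) (ρ : ℝ → ℝ → ℝ) (γm γp : ℝ → ℝ) : Prop :=
  RegSol R ρ ∧ (∀ t, q t ∈ Icc (0:ℝ) fmax) ∧ EntIneq R fmax f q ρ0 ρ ∧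
    LeftTraceAt ρ γm ∧ RightTraceAt ρ γp ∧
    (∀ᵐ t ∂(volume.restrict (Ioi (0:ℝ))), f (γm t) ≤ q t ∧ f (γp t) ≤ q t)

/-- Same as `CEI`, but on the time interval `[0,T)`. -/
def CEIOn (R fmax T : ℝ) (f q ρ0 : ℝ → ℝ) (ρ : ℝ → ℝ → ℝ) (γm γp : ℝ → ℝ) : Prop :=
  RegSol R ρ ∧ (∀ t, q t ∈ Icc (0:ℝ) fmax) ∧ EntIneqOn R fmax T f q ρ0 ρ ∧
    LeftTraceAt ρ γm ∧ RightTraceAt ρ γp ∧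
    (∀ᵐ t ∂(volume.restrict (Ioo (0:ℝ) T)), f (γm t) ≤ q t ∧ f (γp t) ≤ q t)

/-- The weighted average `ξ(t) = ∫_{ℝ₋} w x * ρ t x dx`. -/
def wAvg (w : ℝ → ℝ) (ρ : ℝ → ℝ → ℝ) (t : ℝ) : ℝ := ∫ x in Iic (0:ℝ), w x * ρ t x

/-- Entropy weak solution of the Cauchy problem with non-local point constraint given by
the (possibly multivalued, filled-in) piecewise constant `p`: there is a constraint level
`q` with `q t ∈ P(ξ(t)) = [p(ξ(t)+), p(ξ(t)−)]` a.e. such that `ρ` satisfies the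
constrained entropy inequalities with constraint level `q`. -/
def EWSol (R fmax : ℝ) (f w p ρ0 : ℝ → ℝ) (ρ : ℝ → ℝ → ℝ) (γm γp : ℝ → ℝ) : Prop :=
  ∃ q : ℝ → ℝ, CEI R fmax f q ρ0 ρ γm γp ∧
    ∀ᵐ t ∂(volume.restrict (Ioi (0:ℝ))),
      q t ∈ Icc (pplus R p (wAvg w ρ t)) (pminus p (wAvg w ρ t))

/-- Entropy weak solution with non-local constraint on the time interval `[0,T)`. -/
def EWSolOn (R fmax T : ℝ) (f w p ρ0 : ℝ → ℝ) (ρ : ℝ → ℝ → ℝ) (γm γp : ℝ → ℝ) : Prop :=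
  ∃ q : ℝ → ℝ, CEIOn R fmax T f q ρ0 ρ γm γp ∧
    ∀ᵐ t ∂(volume.restrict (Ioo (0:ℝ) T)),
      q t ∈ Icc (pplus R p (wAvg w ρ t)) (pminus p (wAvg w ρ t))

/-- The Riemann initial datum. -/
def riem (ρL ρR : ℝ) (x : ℝ) : ℝ := if x < 0 then ρL else ρR

/-- `ρ1 = ρ2` a.e. on `(0,T) × ℝ`. -/
def aeEqOn (T : ℝ) (ρ1 ρ2 : ℝ → ℝ → ℝ) : Prop :=
  ∀ᵐ z ∂((volume : Measure (ℝ × ℝ)).restrict (Ioo (0:ℝ) T ×ˢ (univ : Set ℝ))),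
    ρ1 z.1 z.2 = ρ2 z.1 z.2

/-- Lipschitz functions with a.e. positive derivative increase strictly. -/
lemma lip_pos_deriv {f : ℝ → ℝ} {L : NNReal} {a b : ℝ} (hab : a < b)
    (hf : LipschitzOnWith L f (Icc a b))
    (hd : ∀ᵐ x ∂(volume.restrict (Icc a b)), 0 < deriv f x) : f a < f b := by
  have hac : AbsolutelyContinuousOnInterval f a b :=
    LipschitzOnWith.absolutelyContinuousOnInterval (K := L) (by rwa [uIcc_of_le hab.le])
  have h1 := hac.integral_deriv_eq_sub
  have hd' : ∀ᵐ x ∂(volume.restrict (Ioc a b)), 0 < deriv f x :=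
    ae_mono (Measure.restrict_mono Ioc_subset_Icc_self le_rfl) hd
  have h2 : 0 < ∫ x in a..b, deriv f x := by
    rw [intervalIntegral.integral_of_le hab.le]
    rw [integral_pos_iff_support_of_nonneg_ae (hd'.mono fun x hx => hx.le)
      ((intervalIntegrable_iff_integrableOn_Ioc_of_le hab.le).1 hac.intervalIntegrable_deriv)]
    have : (volume.restrict (Ioc a b)) (Function.support (deriv f)) =
        (volume.restrict (Ioc a b)) univ := by
      apply measure_congr
      rw [eventuallyEq_univ]
      filter_upwards [hd'] with x hx
      exact hx.ne'
    rw [this]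
    simp [hab]
  linarith

lemma AF.strictMono {R ρb : ℝ} {f : ℝ → ℝ} (hF : AF R ρb f) :
    StrictMonoOn f (Icc 0 ρb) := by
  obtain ⟨hR, ⟨L, hL⟩, h0, hf0, hfR, hρ, hd⟩ := hF
  intro x hx y hy hxy
  have hsub : Icc x y ⊆ Icc 0 R := Icc_subset_Icc hx.1 (hy.2.trans hρ.2.le)
  refine lip_pos_deriv hxy (hL.mono hsub) ?_
  have h1 := ae_mono (Measure.restrict_mono hsub le_rfl) hd
  have h2 : ∀ᵐ z ∂(volume.restrict (Icc x y)), z ≠ y :=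
    ae_restrict_of_ae (Measure.ae_ne volume y)
  filter_upwards [h1, h2, ae_restrict_mem measurableSet_Icc] with z hz hzy hzm
  have : 0 < ρb - z := by
    have := lt_of_le_of_ne hzm.2 hzy
    linarith [hy.2]
  exact pos_of_mul_pos_left hz this.le

lemma AF.strictAnti {R ρb : ℝ} {f : ℝ → ℝ} (hF : AF R ρb f) :
    StrictAntiOn f (Icc ρb R) := by
  obtain ⟨hR, ⟨L, hL⟩, h0, hf0, hfR, hρ, hd⟩ := hF
  intro x hx y hy hxy
  have hsub : Icc x y ⊆ Icc 0 R := Icc_subset_Icc (hρ.1.le.trans hx.1) hy.2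
  have key : (fun z => - f z) x < (fun z => - f z) y := by
    refine lip_pos_deriv (f := fun z => - f z) (L := L) hxy ?_ ?_
    · exact (hL.mono hsub).neg
    have h1 := ae_mono (Measure.restrict_mono hsub le_rfl) hd
    have h2 : ∀ᵐ z ∂(volume.restrict (Icc x y)), z ≠ x :=
      ae_restrict_of_ae (Measure.ae_ne volume x)
    filter_upwards [h1, h2, ae_restrict_mem measurableSet_Icc] with z hz hzy hzm
    have : ρb - z < 0 := by
      have := lt_of_le_of_ne hzm.1 hzy.symm
      linarith [hx.1]
    rw [deriv.fun_neg]
    nlinarith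
  simpa using key

/-- Quasi-concavity of `f`. -/
lemma AF.quasi {R ρb : ℝ} {f : ℝ → ℝ} (hF : AF R ρb f) {x y k : ℝ}
    (hx : 0 ≤ x) (hy : y ≤ R) (hxk : x ≤ k) (hky : k ≤ y) : min (f x) (f y) ≤ f k := by
  rcases le_total k ρb with h | h
  · exact (min_le_left _ _).trans
      (hF.strictMono.monotoneOn ⟨hx, hxk.trans h⟩ ⟨hx.trans hxk, h⟩ hxk)
  · exact (min_le_right _ _).trans
      (hF.strictAnti.antitoneOn ⟨h, hky.trans hy⟩ ⟨h.trans hky, hy⟩ hky)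

lemma AF.le_max {R ρb : ℝ} {f : ℝ → ℝ} (hF : AF R ρb f) {k : ℝ}
    (hk : k ∈ Icc 0 R) : f k ≤ f ρb := by
  have hρ := hF.2.2.2.2.2.1
  rcases le_total k ρb with h | h
  · exact hF.strictMono.monotoneOn ⟨hk.1, h⟩ ⟨hρ.1.le, le_rfl⟩ h
  · exact hF.strictAnti.antitoneOn ⟨le_rfl, hρ.2.le⟩ ⟨h, hk.2⟩ h

lemma AF.cont {R ρb : ℝ} {f : ℝ → ℝ} (hF : AF R ρb f) : ContinuousOn f (Icc 0 R) := by
  obtain ⟨L, hL⟩ := hF.2.1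
  exact hL.continuousOn

/-- The jump condition at the interface. -/
lemma AF.jump {R ρb : ℝ} {f : ℝ → ℝ} (hF : AF R ρb f) {u v q k : ℝ}
    (hu : u ∈ Icc 0 R) (hv : v ∈ Icc 0 R) (hk : k ∈ Icc 0 R)
    (hfu : f u = q) (hfv : f v = q) :
    -(2 * ((1 - q / f ρb) * f k)) ≤
      Real.sign (u - k) * (f u - f k) - Real.sign (v - k) * (f v - f k) := by
  have hq0 : 0 ≤ q := hfu ▸ hF.2.2.1 u hu
  have hk0 : 0 ≤ f k := hF.2.2.1 k hk
  have hqm : q ≤ f ρb := hfu ▸ hF.le_max hu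
  have hkm : f k ≤ f ρb := hF.le_max hk
  have hd : q / f ρb ≤ 1 := div_le_one_of_le₀ hqm (hq0.trans hqm)
  have hd0 : 0 ≤ q / f ρb := div_nonneg hq0 (hq0.trans hqm)
  have hc : 0 ≤ (1 - q / f ρb) * f k := mul_nonneg (by linarith) hk0
  have hqk : (q / f ρb) * f k ≤ q := by
    rcases (hq0.trans hqm).eq_or_lt with h | h
    · rw [← h]; simpa using hq0
    · rw [div_mul_eq_mul_div, div_le_iff₀ h]
      nlinarith
  have hq1 : u ≤ k → k ≤ v → q ≤ f k := fun h1 h2 => by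
    have := hF.quasi hu.1 hv.2 h1 h2
    rwa [hfu, hfv, min_self] at this
  have hq2 : v ≤ k → k ≤ u → q ≤ f k := fun h1 h2 => by
    have := hF.quasi hv.1 hu.2 h1 h2
    rwa [hfu, hfv, min_self] at this
  rw [hfu, hfv]
  rcases lt_trichotomy u k with h | h | h <;> rcases lt_trichotomy v k with h' | h' | h'
  · rw [Real.sign_of_neg (by linarith), Real.sign_of_neg (by linarith)]; linarith
  · rw [Real.sign_of_neg (by linarith), h', sub_self, Real.sign_zero]
    have := hq1 h.le h'.ge; linarith
  · rw [Real.sign_of_neg (by linarith), Real.sign_of_pos (by linarith)]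
    have := hq1 h.le h'.le; linarith
  · rw [Real.sign_of_neg (r := v - k) (by linarith), h, sub_self, Real.sign_zero]
    have := hq2 h'.le h.ge; linarith
  · rw [h, h', sub_self]; linarith
  · rw [Real.sign_of_pos (r := v - k) (by linarith), h, sub_self, Real.sign_zero]
    have := hq1 h.le h'.le; linarith
  · rw [Real.sign_of_pos (by linarith), Real.sign_of_neg (by linarith)]
    have := hq2 h'.le h.le; linarith
  · rw [Real.sign_of_pos (by linarith), h', sub_self, Real.sign_zero]
    have := hq2 h'.le h.le; linarith
  · rw [Real.sign_of_pos (by linarith), Real.sign_of_pos (by linarith)]; linarith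

/-- `v` selects for each speed `s` a minimizer of `f - s ·` on `[a,b]`. -/
def Sel (f : ℝ → ℝ) (a b : ℝ) (v : ℝ → ℝ) : Prop :=
  ∀ s, v s ∈ Icc a b ∧ ∀ r ∈ Icc a b, f (v s) - s * v s ≤ f r - s * r

lemma exists_sel {f : ℝ → ℝ} {a b : ℝ} (hab : a ≤ b) (hf : ContinuousOn f (Icc a b)) :
    ∃ v, Sel f a b v := by
  have : ∀ s : ℝ, ∃ y, y ∈ Icc a b ∧ ∀ r ∈ Icc a b, f y - s * y ≤ f r - s * r := by
    intro s
    obtain ⟨y, hy, hm⟩ := (isCompact_Icc (a := a) (b := b)).exists_isMinOn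
      (nonempty_Icc.2 hab) (f := fun r => f r - s * r) (hf.sub (by fun_prop))
    exact ⟨y, hy, fun r hr => hm hr⟩
  choose v hv using this
  exact ⟨v, hv⟩

lemma Sel.mono {f : ℝ → ℝ} {a b : ℝ} {v : ℝ → ℝ} (h : Sel f a b v) : Monotone v := by
  intro s t hst
  rcases hst.eq_or_lt with rfl | hlt
  · exact le_rfl
  have h1 := (h s).2 _ (h t).1
  have h2 := (h t).2 _ (h s).1
  by_contra hc
  push Not at hc
  nlinarith [mul_pos (sub_pos.2 hlt) (sub_pos.2 hc)]

/-- Basic entropy decrease along a selection. -/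
lemma Sel.ent {f : ℝ → ℝ} {a b : ℝ} {v : ℝ → ℝ} (h : Sel f a b v) (k s t : ℝ) (hst : s ≤ t) :
    (t - s) * (max 0 (v s - k) + max 0 (k - v t)) ≤
      (Real.sign (v s - k) * (f (v s) - f k) - s * |v s - k|) -
      (Real.sign (v t - k) * (f (v t) - f k) - t * |v t - k|) := by
  have hm := h.mono hst
  have h1 := (h s).2 _ (h t).1
  have h2 := (h t).2 _ (h s).1
  have e1 : ∀ r, k ≤ v r → Real.sign (v r - k) * (f (v r) - f k) - r * |v r - k| =
      (f (v r) - r * v r) - (f k - r * k) := by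
    intro r hr
    rw [abs_of_nonneg (by linarith)]
    rcases hr.eq_or_lt with h' | h'
    · rw [← h']; simp
    · rw [Real.sign_of_pos (by linarith)]; ring
  have e2 : ∀ r, v r ≤ k → Real.sign (v r - k) * (f (v r) - f k) - r * |v r - k| =
      -((f (v r) - r * v r) - (f k - r * k)) := by
    intro r hr
    rw [abs_of_nonpos (by linarith)]
    rcases hr.eq_or_lt with h' | h'
    · rw [← h']; simp
    · rw [Real.sign_of_neg (by linarith)]; ring
  rcases le_total k (v s) with hk | hk
  · rw [e1 s hk, e1 t (hk.trans hm), max_eq_right (by linarith), max_eq_left (by linarith)]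
    nlinarith
  · rcases le_total (v t) k with hk' | hk'
    · rw [e2 s hk, e2 t hk', max_eq_left (by linarith), max_eq_right (by linarith)]
      nlinarith
    · rw [e2 s hk, e1 t hk', max_eq_left (by linarith), max_eq_left (by linarith)]
      have hka : k ∈ Icc a b := ⟨(h s).1.1.trans hk, hk'.trans (h t).1.2⟩
      have := (h s).2 k hka
      have := (h t).2 k hka
      linarith

lemma Sel.left {f : ℝ → ℝ} {a b : ℝ} {v : ℝ → ℝ} {L : NNReal} (h : Sel f a b v)
    (hf : LipschitzOnWith L f (Icc a b)) (hab : a ≤ b) {s : ℝ} (hs : s < -L) : v s = a := by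
  have h1 := (h s).2 a ⟨le_rfl, hab⟩
  have h2 := hf.dist_le_mul _ (h s).1 a ⟨le_rfl, hab⟩
  have h3 := (h s).1.1
  rw [Real.dist_eq, Real.dist_eq, abs_of_nonneg (by linarith : 0 ≤ v s - a)] at h2
  have h4 := neg_abs_le (f (v s) - f a)
  by_contra hc
  have h5 : 0 < v s - a := by
    rcases h3.eq_or_lt with h' | h'
    · exact absurd h'.symm hc
    · linarith
  nlinarith

lemma Sel.right {f : ℝ → ℝ} {a b : ℝ} {v : ℝ → ℝ} {L : NNReal} (h : Sel f a b v)
    (hf : LipschitzOnWith L f (Icc a b)) (hab : a ≤ b) {s : ℝ} (hs : L < s) : v s = b := by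
  have h1 := (h s).2 b ⟨hab, le_rfl⟩
  have h2 := hf.dist_le_mul _ (h s).1 b ⟨hab, le_rfl⟩
  have h3 := (h s).1.2
  rw [Real.dist_eq, Real.dist_eq, abs_sub_comm (v s), abs_of_nonneg (by linarith : 0 ≤ b - v s)] at h2
  have h4 := neg_abs_le (f (v s) - f b)
  by_contra hc
  have h5 : 0 < b - v s := by
    rcases h3.eq_or_lt with h' | h'
    · exact absurd h' hc
    · linarith
  nlinarith

/-- any limit of the selection at speed `0` has flux equal to the minimum `q`. -/
lemma Sel.lim {f : ℝ → ℝ} {a b q γ : ℝ} {v : ℝ → ℝ} (h : Sel f a b v)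
    (hf : ContinuousOn f (Icc a b)) (hq : ∀ r ∈ Icc a b, q ≤ f r)
    (hq' : ∃ r ∈ Icc a b, f r = q) {l : Filter ℝ} [l.NeBot] (hl : l ≤ nhds 0)
    (hv : Tendsto v l (nhds γ)) : γ ∈ Icc a b ∧ f γ = q := by
  have hγ : γ ∈ Icc a b := isClosed_Icc.mem_of_tendsto hv (Eventually.of_forall fun s => (h s).1)
  refine ⟨hγ, ?_⟩
  obtain ⟨r, hr, hrq⟩ := hq'
  have h1 : Tendsto (fun s => f (v s)) l (nhds (f γ)) :=
    (hf γ hγ).tendsto.comp (tendsto_nhdsWithin_iff.2 ⟨hv, Eventually.of_forall fun s => (h s).1⟩)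
  have hid : Tendsto (fun s : ℝ => s) l (nhds 0) := hl
  have h2 : Tendsto (fun s => q + s * (v s - r)) l (nhds (q + 0 * (γ - r))) :=
    (hid.mul (hv.sub_const r)).const_add q
  have h3 : f γ ≤ q + 0 * (γ - r) := by
    refine le_of_tendsto_of_tendsto' h1 h2 fun s => ?_
    have := (h s).2 r hr
    rw [hrq] at this
    linarith
  have := hq γ hγ
  linarith

lemma integrable_of_bdd_supp {α : Type*} [MeasurableSpace α] {μ : Measure α} {u : α → ℝ}
    {s : Set α} {C : ℝ} (hu : AEStronglyMeasurable u μ) (hs : MeasurableSet s) (hμ : μ s ≠ ⊤)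
    (hb : ∀ x, |u x| ≤ s.indicator (fun _ => C) x) : Integrable u μ := by
  have h1 : Integrable (s.indicator (fun _ => C)) μ :=
    (integrableOn_const hμ).integrable_indicator hs
  exact h1.mono' hu (Eventually.of_forall hb)

lemma oneD {v F g : ℝ → ℝ} {k c A B : ℝ} (hc : 0 ≤ c)
    (hvm : Measurable v) (hvb : ∀ s, |v s - k| ≤ B) (hvc : ∀ᵐ s, ContinuousAt v s)
    (hFm : Measurable F) (hFb : ∀ s, |F s| ≤ A * (1 + |s|))
    (hF1 : ∀ s t, s ≤ t → (t < 0 ∨ 0 ≤ s) →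
      (t - s) * (max 0 (v s - k) + max 0 (k - v t)) ≤ F s - F t)
    (hF2 : ∀ s t, s < 0 → 0 ≤ t → -c ≤ F s - F t)
    (hg : ContDiff ℝ 1 g) (hgs : HasCompactSupport g) (hg0 : ∀ s, 0 ≤ g s) :
    -(c * g 0) ≤ ∫ s, (F s * deriv g s - |v s - k| * g s) := by
  have hA : 0 ≤ A := by have := (abs_nonneg _).trans (hFb 0); simpa using this
  have hB : 0 ≤ B := (abs_nonneg _).trans (hvb 0)
  have hgc : Continuous g := hg.continuous
  have hgd : Continuous (deriv g) := hg.continuous_deriv le_rfl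
  have hgdiff : Differentiable ℝ g := hg.differentiable one_ne_zero
  have hgi : Integrable g := hgc.integrable_of_hasCompactSupport hgs
  -- support
  obtain ⟨M, hM0, hM⟩ : ∃ M : ℝ, 0 < M ∧ ∀ s, M < |s| → g s = 0 ∧ deriv g s = 0 := by
    obtain ⟨M, hM⟩ := hgs.isCompact.isBounded.subset_closedBall 0
    refine ⟨max M 1, by positivity, fun s hs => ?_⟩
    have hsn : s ∉ tsupport g := by
      intro h
      have := hM h
      rw [mem_closedBall_zero_iff, Real.norm_eq_abs] at this
      exact absurd (lt_of_le_of_lt (le_max_left _ _) hs) (not_lt.2 this)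
    refine ⟨image_eq_zero_of_notMem_tsupport hsn, ?_⟩
    by_contra h
    exact hsn (support_deriv_subset h)
  -- Lipschitz constant
  obtain ⟨C, hC⟩ := hgs.deriv.exists_bound_of_continuous hgd
  have hC0 : 0 ≤ C := (norm_nonneg _).trans (hC 0)
  have hlip : ∀ x y, |g x - g y| ≤ C * |x - y| := by
    intro x y
    have := Convex.norm_image_sub_le_of_norm_deriv_le (f := g) (s := univ) (C := C)
      (fun x _ => hgdiff x) (fun x _ => hC x) convex_univ (mem_univ y) (mem_univ x)
    simpa using this
  set K : Set ℝ := Icc (-(M+1)) (M+1) with hK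
  have hKn : ∀ s, s ∉ K → M + 1 < |s| := by
    intro s hs
    by_contra h
    push Not at h
    exact hs (abs_le.1 h)
  set D : ℝ := A * (1 + (M+1)) with hD
  have hD0 : 0 ≤ D := by positivity
  have hFK : ∀ s ∈ K, |F s| ≤ D := by
    intro s hs
    refine (hFb s).trans ?_
    have : |s| ≤ M + 1 := abs_le.2 hs
    rw [hD]; gcongr
  -- the left-hand difference quotient
  have hI0 : nhdsWithin (0:ℝ) (Ioi 0) ≤ nhds 0 := nhdsWithin_le_nhds
  have hev : ∀ᶠ h : ℝ in nhdsWithin 0 (Ioi 0), 0 < h ∧ h ≤ 1 := by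
    filter_upwards [Ioc_mem_nhdsGT (show (0:ℝ) < 1 by norm_num)] with h hh using hh
  have bnd : ∀ h : ℝ, 0 < h → h ≤ 1 → ∀ s,
      |F s * ((g (s + h) - g s) / h)| ≤ K.indicator (fun _ => D * C) s := by
    intro h h0 h1 s
    by_cases hs : s ∈ K
    · rw [indicator_of_mem hs, abs_mul]
      refine mul_le_mul (hFK s hs) ?_ (abs_nonneg _) hD0
      rw [abs_div, abs_of_pos h0, div_le_iff₀ h0]
      have := hlip (s + h) s
      rwa [add_sub_cancel_left, abs_of_pos h0] at this
    · rw [indicator_of_notMem hs]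
      have h2 := hKn s hs
      have h3 : g s = 0 := (hM s (by linarith)).1
      have h4 : g (s + h) = 0 := by
        refine (hM _ ?_).1
        have : |s| ≤ |s + h| + |h| := by
          have := abs_sub (s + h) h; simpa using this
        rw [abs_of_pos h0] at this
        linarith
      simp [h3, h4]
  have T1 : Tendsto (fun h : ℝ => ∫ s, F s * ((g (s + h) - g s) / h)) (nhdsWithin 0 (Ioi 0))
      (nhds (∫ s, F s * deriv g s)) := by
    refine tendsto_integral_filter_of_dominated_convergence (K.indicator (fun _ => D * C)) ?_ ?_ ?_ ?_
    · refine Eventually.of_forall fun h => ?_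
      exact (hFm.mul (by fun_prop)).aestronglyMeasurable
    · filter_upwards [hev] with h hh
      exact Eventually.of_forall (bnd h hh.1 hh.2)
    · exact (integrableOn_const (by simp [hK])).integrable_indicator measurableSet_Icc
    · refine Eventually.of_forall fun s => ?_
      refine Tendsto.const_mul _ ?_
      have h1 := (hgdiff s).hasDerivAt.tendsto_slope_zero_right
      refine h1.congr fun h => ?_
      rw [smul_eq_mul, div_eq_inv_mul]
  -- the lower bound
  set E : ℝ → ℝ → ℝ := fun h s =>
    if 0 ≤ s ∧ s < h then 0 else max 0 (v (s - h) - k) + max 0 (k - v s) with hE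
  have hEm : ∀ h, Measurable (E h) := by
    intro h
    refine Measurable.ite ?_ measurable_const ?_
    · exact measurableSet_Ico
    · exact (measurable_const.max ((hvm.comp (by fun_prop)).sub_const k)).add
        (measurable_const.max (measurable_const.sub hvm))
  have hmax1 : ∀ s, max 0 (v s - k) ≤ B := fun s => max_le hB ((le_abs_self _).trans (hvb s))
  have hmax2 : ∀ s, max 0 (k - v s) ≤ B := fun s =>
    max_le hB ((by rw [← neg_sub]; exact neg_le_abs _ : k - v s ≤ |v s - k|).trans (hvb s))
  have hE0 : ∀ h s, 0 ≤ E h s := by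
    intro h s
    simp only [hE]
    split_ifs
    · exact le_rfl
    · exact add_nonneg (le_max_left _ _) (le_max_left _ _)
  have hEb : ∀ h s, |E h s * g s| ≤ 2 * B * g s := by
    intro h s
    rw [abs_of_nonneg (mul_nonneg (hE0 h s) (hg0 s))]
    refine mul_le_mul_of_nonneg_right ?_ (hg0 s)
    simp only [hE]
    split_ifs
    · positivity
    · linarith [hmax1 (s - h), hmax2 s]
  have hEi : ∀ h, Integrable (fun s => E h s * g s) := fun h =>
    (hgi.const_mul (2 * B)).mono' ((hEm h).mul hgc.measurable).aestronglyMeasurable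
      (Eventually.of_forall (hEb h))
  have T2 : Tendsto (fun h : ℝ => ∫ s, E h s * g s) (nhdsWithin 0 (Ioi 0))
      (nhds (∫ s, |v s - k| * g s)) := by
    refine tendsto_integral_filter_of_dominated_convergence (fun s => 2 * B * g s) ?_ ?_ ?_ ?_
    · exact Eventually.of_forall fun h => (hEi h).aestronglyMeasurable
    · exact Eventually.of_forall fun h => Eventually.of_forall (hEb h)
    · exact hgi.const_mul _
    · filter_upwards [hvc, Measure.ae_ne volume (0:ℝ)] with s hs hs0
      refine Tendsto.mul_const _ ?_
      have h1 : Tendsto (fun h : ℝ => v (s - h)) (nhdsWithin 0 (Ioi 0)) (nhds (v s)) := by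
        refine Tendsto.mono_left ?_ hI0
        refine hs.tendsto.comp ?_
        have : Tendsto (fun h : ℝ => s - h) (nhds 0) (nhds (s - 0)) :=
          (continuous_const.sub continuous_id).tendsto 0
        simpa using this
      have h2 : Tendsto (fun h : ℝ => max 0 (v (s - h) - k) + max 0 (k - v s))
          (nhdsWithin 0 (Ioi 0)) (nhds (max 0 (v s - k) + max 0 (k - v s))) :=
        (tendsto_const_nhds.max (h1.sub_const k)).add_const _
      have h3 : max 0 (v s - k) + max 0 (k - v s) = |v s - k| := by
        rcases le_total k (v s) with h | h
        · rw [max_eq_right (by linarith), max_eq_left (by linarith), abs_of_nonneg (by linarith)]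
          ring
        · rw [max_eq_left (by linarith), max_eq_right (by linarith), abs_of_nonpos (by linarith)]
          ring
      rw [h3] at h2
      refine h2.congr' ?_
      have h4 : ∀ᶠ h : ℝ in nhdsWithin 0 (Ioi 0), ¬ (0 ≤ s ∧ s < h) := by
        rcases lt_or_gt_of_ne hs0 with h' | h'
        · exact Eventually.of_forall fun h hh => absurd hh.1 (not_le.2 h')
        · filter_upwards [Ioc_mem_nhdsGT h'] with h hh
          intro hh'
          exact absurd hh'.2 (not_lt.2 hh.2)
      filter_upwards [h4] with h hh
      simp only [hE]
      rw [if_neg hh]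
  have T3 : Tendsto (fun h : ℝ => c * (g 0 + C * h)) (nhdsWithin 0 (Ioi 0)) (nhds (c * g 0)) := by
    refine Tendsto.mono_left ?_ hI0
    have : Continuous fun h : ℝ => c * (g 0 + C * h) := by fun_prop
    simpa using this.tendsto 0
  have main : ∀ᶠ h : ℝ in nhdsWithin 0 (Ioi 0),
      (∫ s, E h s * g s) - c * (g 0 + C * h) ≤ ∫ s, F s * ((g (s + h) - g s) / h) := by
    filter_upwards [hev] with h ⟨h0, h1⟩
    have i1 : Integrable (fun s => F s * g s / h) := by
      refine integrable_of_bdd_supp (s := K) (C := D * (C * (2 * M + 2)) / h)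
        ((hFm.mul hgc.measurable).div_const h).aestronglyMeasurable
        measurableSet_Icc (by simp [hK]) fun s => ?_
      by_cases hs : s ∈ K
      · rw [indicator_of_mem hs, abs_div, abs_mul, abs_of_pos h0]
        gcongr
        · exact hFK s hs
        · have h2 := hlip s (M+1)
          have h3 : g (M + 1) = 0 := (hM _ (by rw [abs_of_pos] <;> linarith)).1
          rw [h3, sub_zero] at h2
          refine h2.trans ?_
          gcongr
          rw [abs_le]
          constructor <;> linarith [hs.1, hs.2]
      · rw [indicator_of_notMem hs, (hM s (by linarith [hKn s hs])).1]
        simp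
    have i0 : Integrable (fun s => F s * ((g (s + h) - g s) / h)) := by
      refine integrable_of_bdd_supp (s := K) (C := D * C)
        (hFm.mul (by fun_prop)).aestronglyMeasurable
        measurableSet_Icc (by simp [hK]) (bnd h h0 h1)
    have i2 : Integrable (fun s => F s * g (s + h) / h) := by
      refine (i0.add i1).congr (Eventually.of_forall fun s => ?_)
      simp only [Pi.add_apply]
      ring
    have i3 : Integrable (fun s => F (s - h) * g s / h) := by
      have := i2.comp_sub_right h
      simpa using this
    have e1 : ∫ s, F s * ((g (s + h) - g s) / h) = ∫ s, (F (s - h) * g s / h - F s * g s / h) := by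
      rw [integral_sub i3 i1]
      have : ∫ s, F (s - h) * g s / h = ∫ s, F s * g (s + h) / h := by
        have := integral_sub_right_eq_self (μ := volume) (fun s => F s * g (s + h) / h) h
        rw [← this]
        simp
      rw [this, ← integral_sub i2 i1]
      congr 1
      ext s
      ring
    have i4 : Integrable ((Ico 0 h).indicator (fun _ : ℝ => c / h * (g 0 + C * h))) :=
      (integrableOn_const (by simp)).integrable_indicator measurableSet_Ico
    have e2 : (∫ s, E h s * g s) - c * (g 0 + C * h) =
        ∫ s, (E h s * g s - (Ico 0 h).indicator (fun _ : ℝ => c / h * (g 0 + C * h)) s) := by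
      rw [integral_sub (hEi h) i4, integral_indicator measurableSet_Ico]
      simp [h0.le]
      field_simp
    rw [e1, e2]
    refine integral_mono ((hEi h).sub i4) (i3.sub i1) fun s => ?_
    have e3 : F (s - h) * g s / h - F s * g s / h = (F (s - h) - F s) / h * g s := by ring
    simp only [e3]
    by_cases hs : 0 ≤ s ∧ s < h
    · have hs' : s ∈ Ico 0 h := hs
      rw [indicator_of_mem hs']
      simp only [hE]
      rw [if_pos hs]
      have h2 := hF2 (s - h) s (by linarith [hs.2]) hs.1
      have h3 : g s ≤ g 0 + C * h := by
        have h4 := (abs_le.1 (hlip s 0)).2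
        rw [sub_zero, abs_of_nonneg hs.1] at h4
        have : C * s ≤ C * h := mul_le_mul_of_nonneg_left hs.2.le hC0
        linarith
      have h4 : -c / h ≤ (F (s - h) - F s) / h := by gcongr
      have h5 : (-c / h) * g s ≤ (F (s - h) - F s) / h * g s :=
        mul_le_mul_of_nonneg_right h4 (hg0 s)
      have h6 : c / h * g s ≤ c / h * (g 0 + C * h) :=
        mul_le_mul_of_nonneg_left h3 (by positivity)
      rw [neg_div] at h5
      linarith
    · have hs' : s ∉ Ico 0 h := hs
      rw [indicator_of_notMem hs', sub_zero]
      refine mul_le_mul_of_nonneg_right ?_ (hg0 s)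
      simp only [hE]
      rw [if_neg hs, le_div_iff₀ h0]
      have h2 := hF1 (s - h) s (by linarith) (by
        rcases lt_or_ge s 0 with h' | h'
        · exact Or.inl h'
        · right
          by_contra h''
          exact hs ⟨h', by linarith⟩)
      rw [sub_sub_cancel] at h2
      linarith
  have lim := le_of_tendsto_of_tendsto (T2.sub T3) T1 main
  have j1 : Integrable (fun s => F s * deriv g s) := by
    refine integrable_of_bdd_supp (s := K) (C := D * C)
        (hFm.mul hgd.measurable).aestronglyMeasurable
        measurableSet_Icc (by simp [hK]) fun s => ?_
    by_cases hs : s ∈ K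
    · rw [indicator_of_mem hs, abs_mul]
      exact mul_le_mul (hFK s hs) (hC s) (abs_nonneg _) hD0
    · rw [indicator_of_notMem hs, (hM s (by linarith [hKn s hs])).2]
      simp
  have j2 : Integrable (fun s => |v s - k| * g s) := by
    refine (hgi.const_mul B).mono' ?_ (Eventually.of_forall fun s => ?_)
    · exact ((hvm.sub_const k).abs.mul hgc.measurable).aestronglyMeasurable
    · rw [Real.norm_eq_abs, abs_mul, abs_abs, abs_of_nonneg (hg0 s)]
      exact mul_le_mul_of_nonneg_right (hvb s) (hg0 s)
  rw [integral_sub j1 j2]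
  linarith

lemma integrable_of_bdd_supp' {α : Type*} [MeasurableSpace α] {μ : Measure α} {u : α → ℝ}
    {s : Set α} {C : ℝ} (hu : AEStronglyMeasurable u μ) (hs : MeasurableSet s) (hμ : μ s ≠ ⊤)
    (hb : ∀ᵐ x ∂μ, |u x| ≤ s.indicator (fun _ => C) x) : Integrable u μ := by
  have h1 : Integrable (s.indicator (fun _ => C)) μ :=
    (integrableOn_const hμ).integrable_indicator hs
  exact h1.mono' hu hb

lemma tendsto_Ioi_integral {u : ℝ → ℝ} (hu : IntegrableOn u (Ioi 0)) :
    Tendsto (fun δ : ℝ => ∫ t in Ioi δ, u t) (nhdsWithin 0 (Ioi 0))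
      (nhds (∫ t in Ioi (0:ℝ), u t)) := by
  have e : ∀ δ : ℝ, ∫ t in Ioi δ, u t = ∫ t, (Ioi δ).indicator u t := fun δ =>
    (integral_indicator measurableSet_Ioi).symm
  simp only [e]
  have hi := hu.integrable_indicator measurableSet_Ioi
  refine tendsto_integral_filter_of_dominated_convergence (fun t => ‖(Ioi (0:ℝ)).indicator u t‖)
    ?_ ?_ hi.norm ?_
  · filter_upwards [self_mem_nhdsWithin] with δ hδ
    exact ((hu.mono_set (Ioi_subset_Ioi (le_of_lt hδ))).integrable_indicator
      measurableSet_Ioi).aestronglyMeasurable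
  · filter_upwards [self_mem_nhdsWithin] with δ hδ
    refine Eventually.of_forall fun t => ?_
    exact norm_indicator_le_of_subset (Ioi_subset_Ioi (le_of_lt hδ)) u t
  · refine Eventually.of_forall fun t => ?_
    rcases le_or_gt t 0 with ht | ht
    · refine tendsto_const_nhds.congr' ?_
      filter_upwards [self_mem_nhdsWithin] with δ hδ
      have h1 : t ∉ Ioi (0:ℝ) := not_lt.2 ht
      have h2 : t ∉ Ioi δ := not_lt.2 (ht.trans (le_of_lt hδ))
      rw [indicator_of_notMem h1, indicator_of_notMem h2]
    · refine tendsto_const_nhds.congr' ?_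
      filter_upwards [Ioo_mem_nhdsGT ht] with δ hδ
      rw [indicator_of_mem (show t ∈ Ioi (0:ℝ) from ht), indicator_of_mem (show t ∈ Ioi δ from hδ.2)]

/-- Bounds for test functions. -/
lemma TestFn.bounds {φ : ℝ × ℝ → ℝ} (hφ : TestFn φ) :
    Continuous φ ∧ Continuous (pdT φ) ∧ Continuous (pdX φ) ∧ Differentiable ℝ φ ∧
    ∃ M C : ℝ, 0 < M ∧ 0 ≤ C ∧
      (∀ z, |φ z| ≤ C ∧ |pdT φ z| ≤ C ∧ |pdX φ z| ≤ C) ∧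
      (∀ z, (M < |z.1| ∨ M < |z.2|) → φ z = 0 ∧ pdT φ z = 0 ∧ pdX φ z = 0) := by
  obtain ⟨hc, hs⟩ := hφ
  have hd : Continuous (fderiv ℝ φ) := hc.continuous_fderiv (by simp)
  have c1 : Continuous (pdT φ) := hd.clm_apply continuous_const
  have c2 : Continuous (pdX φ) := hd.clm_apply continuous_const
  refine ⟨hc.continuous, c1, c2, hc.differentiable (by simp), ?_⟩
  obtain ⟨M, hM⟩ := hs.isCompact.isBounded.subset_closedBall 0
  have hn : ∀ z : ℝ × ℝ, (max M 1 < |z.1| ∨ max M 1 < |z.2|) → z ∉ tsupport φ := by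
    intro z hz h
    have := hM h
    rw [mem_closedBall_zero_iff, Prod.norm_def, Real.norm_eq_abs, Real.norm_eq_abs] at this
    have h1 := (le_max_left |z.1| |z.2|).trans this
    have h2 := (le_max_right |z.1| |z.2|).trans this
    rcases hz with hz | hz
    · linarith [le_max_left M 1]
    · linarith [le_max_left M 1]
  have hfd : ∀ z, z ∉ tsupport φ → fderiv ℝ φ z = 0 := by
    intro z hz
    by_contra h
    exact hz (support_fderiv_subset ℝ h)
  have s1 : HasCompactSupport (pdT φ) := by
    refine HasCompactSupport.intro hs fun z hz => ?_
    simp [pdT, hfd z hz]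
  have s2 : HasCompactSupport (pdX φ) := by
    refine HasCompactSupport.intro hs fun z hz => ?_
    simp [pdX, hfd z hz]
  obtain ⟨C0, h0⟩ := hs.exists_bound_of_continuous hc.continuous
  obtain ⟨C1, h1⟩ := s1.exists_bound_of_continuous c1
  obtain ⟨C2, h2⟩ := s2.exists_bound_of_continuous c2
  have p0 := (norm_nonneg _).trans (h0 0)
  have p1 := (norm_nonneg _).trans (h1 0)
  have p2 := (norm_nonneg _).trans (h2 0)
  refine ⟨max M 1, C0 + C1 + C2, by positivity, by positivity, fun z => ⟨?_, ?_, ?_⟩, fun z hz => ?_⟩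
  · have := h0 z; rw [Real.norm_eq_abs] at this; linarith
  · have := h1 z; rw [Real.norm_eq_abs] at this; linarith
  · have := h2 z; rw [Real.norm_eq_abs] at this; linarith
  · have := hn z hz
    exact ⟨image_eq_zero_of_notMem_tsupport this, by simp [pdT, hfd z this],
      by simp [pdX, hfd z this]⟩

lemma hasDeriv_s {φ : ℝ × ℝ → ℝ} (hφ : Differentiable ℝ φ) (t s : ℝ) :
    HasDerivAt (fun s => φ (t, t * s)) (t * pdX φ (t, t * s)) s := by
  have h1 : HasDerivAt (fun s : ℝ => (t, t * s)) ((0:ℝ), t) s := by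
    refine (hasDerivAt_const s t).prodMk ?_
    simpa using (hasDerivAt_id s).const_mul t
  have h2 := (hφ (t, t * s)).hasFDerivAt.comp_hasDerivAt s h1
  have h3 : fderiv ℝ φ (t, t * s) (0, t) = t * pdX φ (t, t * s) := by
    have : ((0:ℝ), t) = t • ((0:ℝ), (1:ℝ)) := by simp
    rw [this, map_smul]; rfl
  rw [h3] at h2
  exact h2

lemma hasDeriv_t {φ : ℝ × ℝ → ℝ} (hφ : Differentiable ℝ φ) (t s : ℝ) :
    HasDerivAt (fun t => t * φ (t, t * s))
      (φ (t, t * s) + t * pdT φ (t, t * s) + t * s * pdX φ (t, t * s)) t := by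
  have h1 : HasDerivAt (fun t : ℝ => (t, t * s)) ((1:ℝ), s) t := by
    refine (hasDerivAt_id t).prodMk ?_
    simpa using (hasDerivAt_id t).mul_const s
  have h2 := (hφ (t, t * s)).hasFDerivAt.comp_hasDerivAt t h1
  have h3 : fderiv ℝ φ (t, t * s) (1, s) = pdT φ (t, t * s) + s * pdX φ (t, t * s) := by
    have : ((1:ℝ), s) = ((1:ℝ), (0:ℝ)) + s • ((0:ℝ), (1:ℝ)) := by simp
    rw [this, map_add, map_smul]; rfl
  rw [h3] at h2
  have h4 := (hasDerivAt_id t).mul h2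
  refine h4.congr_deriv ?_
  simp only [Function.comp, id]
  ring

lemma integral_scale {u : ℝ → ℝ → ℝ} {t : ℝ} (ht : 0 < t) :
    ∫ x, u (x / t) x = t * ∫ s, u s (t * s) := by
  have h := Measure.integral_comp_div (fun s => u s (t * s)) t
  rw [abs_of_pos ht, smul_eq_mul] at h
  rw [← h]
  congr 1
  ext x
  rw [mul_div_cancel₀ _ ht.ne']

lemma twoD {v Ψ : ℝ → ℝ} {k c A B S uL uR : ℝ} (hc : 0 ≤ c)
    (hvm : Measurable v) (hvb : ∀ s, |v s - k| ≤ B) (hvc : ∀ᵐ s, ContinuousAt v s)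
    (hΨm : Measurable Ψ) (hΨb : ∀ s, |Ψ s| ≤ A)
    (hF1 : ∀ s t, s ≤ t → (t < 0 ∨ 0 ≤ s) →
      (t - s) * (max 0 (v s - k) + max 0 (k - v t)) ≤
        (Ψ s - s * |v s - k|) - (Ψ t - t * |v t - k|))
    (hF2 : ∀ s t, s < 0 → 0 ≤ t → -c ≤ (Ψ s - s * |v s - k|) - (Ψ t - t * |v t - k|))
    (hSl : ∀ s, s < -S → v s = uL) (hSr : ∀ s, S < s → v s = uR)
    {φ : ℝ × ℝ → ℝ} (hφ : TestFn φ) (hφ0 : ∀ z, 0 ≤ φ z) :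
    0 ≤ (∫ t in Ioi (0:ℝ), ∫ x : ℝ,
          (|v (x / t) - k| * pdT φ (t, x) + Ψ (x / t) * pdX φ (t, x))) +
        c * (∫ t in Ioi (0:ℝ), φ (t, 0)) +
        ∫ x : ℝ, |riem uL uR x - k| * φ (0, x) := by
  obtain ⟨hc0, hcT, hcX, hdiff, M, C, hM0, hC0, hC, hM⟩ := hφ.bounds
  have hA : 0 ≤ A := (abs_nonneg _).trans (hΨb 0)
  have hB : 0 ≤ B := (abs_nonneg _).trans (hvb 0)
  have mη : Measurable fun s => |v s - k| := (hvm.sub_const k).abs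
  set P : ℝ → ℝ → ℝ := fun t x =>
    |v (x / t) - k| * pdT φ (t, x) + Ψ (x / t) * pdX φ (t, x) with hP
  set L : ℝ → ℝ := fun t => ∫ x, P t x with hL
  have hnot : ∀ x : ℝ, x ∉ Icc (-M) M → M < |x| := by
    intro x hx
    by_contra h
    exact hx (abs_le.1 (not_lt.1 h))
  -- integrability of P
  have hPm : Measurable (Function.uncurry P) := by
    have h1 : Measurable fun z : ℝ × ℝ => z.2 / z.1 := measurable_snd.div measurable_fst
    exact ((mη.comp h1).mul hcT.measurable).add ((hΨm.comp h1).mul hcX.measurable)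
  have hPi : Integrable (Function.uncurry P) ((volume.restrict (Ioi (0:ℝ))).prod volume) := by
    refine integrable_of_bdd_supp (s := Icc (-M) M ×ˢ Icc (-M) M) (C := B * C + A * C)
      hPm.aestronglyMeasurable (measurableSet_Icc.prod measurableSet_Icc) ?_ ?_
    · rw [Measure.prod_prod]
      refine ENNReal.mul_ne_top ?_ (by simp)
      exact ((Measure.restrict_apply_le _ _).trans_lt (by simp)).ne
    · rintro ⟨t, x⟩
      by_cases hz : (t, x) ∈ Icc (-M) M ×ˢ Icc (-M) M
      · rw [indicator_of_mem hz]
        simp only [Function.uncurry, hP]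
        refine (abs_add_le _ _).trans ?_
        rw [abs_mul, abs_mul, abs_abs]
        gcongr
        · exact hvb _
        · exact (hC _).2.1
        · exact hΨb _
        · exact (hC _).2.2
      · rw [indicator_of_notMem hz]
        have : M < |t| ∨ M < |x| := by
          by_contra h
          push Not at h
          exact hz ⟨abs_le.1 h.1, abs_le.1 h.2⟩
        obtain ⟨-, h1, h2⟩ := hM (t, x) this
        simp [Function.uncurry, hP, h1, h2]
  have hLi : IntegrableOn L (Ioi 0) := hPi.integral_prod_left
  set ψ : ℝ → ℝ → ℝ := fun t s =>
    φ (t, t * s) + t * pdT φ (t, t * s) + t * s * pdX φ (t, t * s) with hψ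
  have hψc : Continuous (Function.uncurry ψ) := by
    simp only [hψ, Function.uncurry_def]
    fun_prop
  have hψb : ∀ t s, |ψ t s| ≤ C + M * C + M * C := by
    intro t s
    by_cases hz : M < |t| ∨ M < |t * s|
    · obtain ⟨h0, h1, h2⟩ := hM (t, t * s) hz
      simp only [hψ, h0, h1, h2]
      simp
      positivity
    · push Not at hz
      simp only [hψ]
      refine (abs_add_three _ _ _).trans ?_
      rw [abs_mul t, abs_mul (t * s)]
      gcongr
      · exact (hC _).1
      · exact hz.1
      · exact (hC _).2.1
      · exact hz.2
      · exact (hC _).2.2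
  have hφ0i : Integrable fun t => φ (t, 0) := by
    refine integrable_of_bdd_supp (s := Icc (-M) M) (C := C)
      (by fun_prop : Continuous fun t => φ (t, 0)).aestronglyMeasurable measurableSet_Icc (by simp) fun t => ?_
    by_cases ht : t ∈ Icc (-M) M
    · rw [indicator_of_mem ht]; exact (hC _).1
    · rw [indicator_of_notMem ht, (hM (t, 0) (Or.inl (hnot t ht))).1]; simp
  -- the key one-dimensional inequality
  have key : ∀ t, 0 < t → (∫ s, |v s - k| * ψ t s) - c * φ (t, 0) ≤ L t := by
    intro t ht
    have hg : ContDiff ℝ 1 (fun s => φ (t, t * s)) := by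
      have : ContDiff ℝ 1 φ := hφ.1.of_le (by simp)
      exact this.comp (by fun_prop)
    have hzero : ∀ s, s ∉ Icc (-(M / t)) (M / t) → M < |t * s| := by
      intro s hs
      by_contra h
      push Not at h
      apply hs
      rw [abs_mul, abs_of_pos ht] at h
      refine abs_le.1 ?_
      rw [le_div_iff₀ ht]
      linarith
    have hgs : HasCompactSupport (fun s => φ (t, t * s)) := by
      refine HasCompactSupport.intro (isCompact_Icc (a := -(M / t)) (b := M / t)) fun s hs => ?_
      exact (hM _ (Or.inr (hzero s hs))).1
    have h1 := oneD (F := fun s => Ψ s - s * |v s - k|) (A := A + B) hc hvm hvb hvc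
      (hΨm.sub (measurable_id.mul mη)) (fun s => by
        refine (abs_sub _ _).trans ?_
        rw [abs_mul, abs_abs]
        have h2 := hvb s
        have h3 : |s| * |v s - k| ≤ |s| * B := mul_le_mul_of_nonneg_left h2 (abs_nonneg s)
        have h4 := hΨb s
        nlinarith [mul_nonneg hA (abs_nonneg s)]) hF1 hF2 hg hgs (fun s => hφ0 _)
    simp only [mul_zero] at h1
    have h2 : ∀ s, deriv (fun s => φ (t, t * s)) s = t * pdX φ (t, t * s) := fun s =>
      (hasDeriv_s hdiff t s).deriv
    simp only [h2] at h1
    have h3 : L t = t * ∫ s, (|v s - k| * pdT φ (t, t * s) + Ψ s * pdX φ (t, t * s)) :=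
      integral_scale (u := fun s x => |v s - k| * pdT φ (t, x) + Ψ s * pdX φ (t, x)) ht
    rw [← integral_const_mul] at h3
    have i1 : Integrable fun s => |v s - k| * ψ t s := by
      refine integrable_of_bdd_supp (s := Icc (-(M/t)) (M/t)) (C := B * (C + M * C + M * C))
        (mη.mul (by
          have : Continuous (ψ t) := hψc.uncurry_left t
          exact this.measurable)).aestronglyMeasurable measurableSet_Icc (by simp) fun s => ?_
      by_cases hs : s ∈ Icc (-(M/t)) (M/t)
      · rw [indicator_of_mem hs, abs_mul, abs_abs]
        exact mul_le_mul (hvb s) (hψb t s) (abs_nonneg _) hB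
      · rw [indicator_of_notMem hs]
        obtain ⟨h0, h1, h2⟩ := hM (t, t * s) (Or.inr (hzero s hs))
        simp [hψ, h0, h1, h2]
    have i2 : Integrable fun s =>
        t * (|v s - k| * pdT φ (t, t * s) + Ψ s * pdX φ (t, t * s)) := by
      refine Integrable.const_mul ?_ t
      refine integrable_of_bdd_supp (s := Icc (-(M/t)) (M/t)) (C := B * C + A * C)
        ((mη.mul (by fun_prop)).add (hΨm.mul (by fun_prop))).aestronglyMeasurable
        measurableSet_Icc (by simp) fun s => ?_
      by_cases hs : s ∈ Icc (-(M/t)) (M/t)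
      · rw [indicator_of_mem hs]
        refine (abs_add_le _ _).trans ?_
        rw [abs_mul, abs_mul, abs_abs]
        gcongr
        · exact hvb _
        · exact (hC _).2.1
        · exact hΨb _
        · exact (hC _).2.2
      · rw [indicator_of_notMem hs]
        obtain ⟨h0, h1, h2⟩ := hM (t, t * s) (Or.inr (hzero s hs))
        simp [h1, h2]
    have h4 : ∫ s, ((Ψ s - s * |v s - k|) * (t * pdX φ (t, t * s)) - |v s - k| * φ (t, t * s)) =
        L t - ∫ s, |v s - k| * ψ t s := by
      rw [h3, ← integral_sub i2 i1]
      congr 1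
      ext s
      simp only [hψ]
      ring
    rw [h4] at h1
    linarith
  -- for positive δ
  set J : ℝ → ℝ := fun δ => ∫ x, |v (x / δ) - k| * φ (δ, x) with hJ
  have step : ∀ δ, 0 < δ → -(J δ) - c * (∫ t in Ioi δ, φ (t, 0)) ≤ ∫ t in Ioi δ, L t := by
    intro δ hδ
    have hQi : Integrable (Function.uncurry fun t s => |v s - k| * ψ t s)
        ((volume.restrict (Ioi δ)).prod volume) := by
      refine integrable_of_bdd_supp' (s := Icc (-M) M ×ˢ Icc (-(M/δ)) (M/δ))
        (C := B * (C + M * C + M * C)) ?_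
        (measurableSet_Icc.prod measurableSet_Icc) ?_ ?_
      · exact ((mη.comp measurable_snd).mul hψc.measurable).aestronglyMeasurable
      · rw [Measure.prod_prod]
        refine ENNReal.mul_ne_top ?_ (by simp)
        exact ((Measure.restrict_apply_le _ _).trans_lt (by simp)).ne
      · have h1 : ∀ᵐ z : ℝ × ℝ ∂((volume.restrict (Ioi δ)).prod volume), z.1 ∈ Ioi δ :=
          Measure.quasiMeasurePreserving_fst.ae (ae_restrict_mem measurableSet_Ioi)
        filter_upwards [h1] with z hz
        obtain ⟨t, s⟩ := z
        have hz' : δ < t := hz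
        by_cases hz2 : (t, s) ∈ Icc (-M) M ×ˢ Icc (-(M/δ)) (M/δ)
        · rw [indicator_of_mem hz2]
          simp only [Function.uncurry]
          rw [abs_mul, abs_abs]
          exact mul_le_mul (hvb s) (hψb t s) (abs_nonneg _) hB
        · rw [indicator_of_notMem hz2]
          have : M < |t| ∨ M < |t * s| := by
            by_contra h
            push Not at h
            refine hz2 ⟨abs_le.1 h.1, abs_le.1 ?_⟩
            rw [le_div_iff₀ hδ]
            have h2 := h.2
            rw [abs_mul, abs_of_pos (hδ.trans hz')] at h2
            nlinarith [abs_nonneg s]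
          obtain ⟨h0, h1, h2⟩ := hM (t, t * s) this
          simp [Function.uncurry, hψ, h0, h1, h2]
    have hQ : ∫ t in Ioi δ, ∫ s, |v s - k| * ψ t s = -(J δ) := by
      rw [integral_integral_swap hQi]
      have h1 : ∀ s, ∫ t in Ioi δ, |v s - k| * ψ t s = -(δ * (|v s - k| * φ (δ, δ * s))) := by
        intro s
        rw [integral_const_mul]
        have hcs : Continuous fun t => ψ t s := hψc.uncurry_right s
        have h2 : ∫ t in Ioi δ, ψ t s = 0 - δ * φ (δ, δ * s) := by
          refine integral_Ioi_of_hasDerivAt_of_tendsto' (f := fun t => t * φ (t, t * s))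
            (fun t _ => hasDeriv_t hdiff t s) ?_ ?_
          · refine Integrable.integrableOn ?_
            refine integrable_of_bdd_supp (s := Icc (-M) M) (C := C + M * C + M * C)
              hcs.aestronglyMeasurable measurableSet_Icc (by simp) fun t => ?_
            by_cases ht : t ∈ Icc (-M) M
            · rw [indicator_of_mem ht]; exact hψb t s
            · rw [indicator_of_notMem ht]
              obtain ⟨h0, h1, h2⟩ := hM (t, t * s) (Or.inl (hnot t ht))
              simp [hψ, h0, h1, h2]
          · refine tendsto_const_nhds.congr' ?_
            filter_upwards [eventually_gt_atTop M] with t ht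
            rw [(hM (t, t * s) (Or.inl (lt_of_lt_of_le ht (le_abs_self t)))).1, mul_zero]
        rw [h2]; ring
      simp only [h1]
      rw [integral_neg, integral_const_mul]
      congr 1
      exact (integral_scale (u := fun s x => |v s - k| * φ (δ, x)) hδ).symm
    have hQ1 : Integrable (fun t => ∫ s, |v s - k| * ψ t s) (volume.restrict (Ioi δ)) :=
      hQi.integral_prod_left
    rw [← hQ, ← integral_const_mul, ← integral_sub hQ1
      (hφ0i.const_mul c).integrableOn]
    refine setIntegral_mono_on (hQ1.sub (hφ0i.const_mul c).integrableOn)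
      (hLi.mono_set (Ioi_subset_Ioi hδ.le)) measurableSet_Ioi fun t ht => ?_
    exact key t (hδ.trans ht)
  -- limits
  have TJ : Tendsto J (nhdsWithin 0 (Ioi 0)) (nhds (∫ x : ℝ, |riem uL uR x - k| * φ (0, x))) := by
    refine tendsto_integral_filter_of_dominated_convergence
      ((Icc (-M) M).indicator fun _ => B * C) ?_ ?_ ?_ ?_
    · refine Eventually.of_forall fun δ => ?_
      exact ((mη.comp (measurable_id.div_const δ)).mul (by fun_prop)).aestronglyMeasurable
    · refine Eventually.of_forall fun δ => Eventually.of_forall fun x => ?_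
      rw [Real.norm_eq_abs]
      by_cases hx : x ∈ Icc (-M) M
      · rw [indicator_of_mem hx, abs_mul, abs_abs]
        exact mul_le_mul (hvb _) (hC _).1 (abs_nonneg _) hB
      · rw [indicator_of_notMem hx, (hM (δ, x) (Or.inr (hnot x hx))).1]; simp
    · exact (integrableOn_const (by simp)).integrable_indicator measurableSet_Icc
    · filter_upwards [Measure.ae_ne volume (0:ℝ)] with x hx
      have h1 : Tendsto (fun δ : ℝ => φ (δ, x)) (nhdsWithin 0 (Ioi 0)) (nhds (φ (0, x))) :=
        ((by fun_prop : Continuous fun δ : ℝ => φ (δ, x)).tendsto 0).mono_left nhdsWithin_le_nhds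
      refine Tendsto.mul ?_ h1
      refine tendsto_const_nhds.congr' ?_
      have h2 : Tendsto (fun δ : ℝ => δ * S) (nhdsWithin 0 (Ioi 0)) (nhds 0) := by
        have := (by fun_prop : Continuous fun δ : ℝ => δ * S).tendsto 0
        rw [zero_mul] at this
        exact this.mono_left nhdsWithin_le_nhds
      filter_upwards [h2.eventually (gt_mem_nhds (abs_pos.2 hx)), self_mem_nhdsWithin] with δ h3 h4
      have h4' : 0 < δ := h4
      rcases lt_or_gt_of_ne hx with hx' | hx'
      · rw [abs_of_neg hx'] at h3
        rw [hSl (x / δ) (by rw [div_lt_iff₀ h4']; linarith)]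
        simp [riem, hx']
      · rw [abs_of_pos hx'] at h3
        rw [hSr (x / δ) (by rw [lt_div_iff₀ h4']; linarith)]
        simp [riem, not_lt.2 hx'.le]
  have T1 := tendsto_Ioi_integral hLi
  have T2 := tendsto_Ioi_integral (hφ0i.integrableOn (s := Ioi 0))
  have lim := le_of_tendsto_of_tendsto (TJ.neg.sub (T2.const_mul c)) T1
    (by filter_upwards [self_mem_nhdsWithin] with δ hδ using step δ hδ)
  linarith

lemma measurable_sign' : Measurable Real.sign := by
  unfold Real.sign
  refine Measurable.ite measurableSet_Iio measurable_const ?_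
  exact Measurable.ite measurableSet_Ioi measurable_const measurable_const

/-- Glue two profiles at speed `0`. -/
def prof (v1 v2 : ℝ → ℝ) (s : ℝ) : ℝ := if s < 0 then v1 s else v2 s

/-- The self-similar solution with profile `v`. -/
def sol (uL uR : ℝ) (v : ℝ → ℝ) (t x : ℝ) : ℝ := if t ≤ 0 then riem uL uR x else v (x / t)

lemma prof_meas {v1 v2 : ℝ → ℝ} (h1 : Monotone v1) (h2 : Monotone v2) :
    Measurable (prof v1 v2) :=
  Measurable.ite measurableSet_Iio h1.measurable h2.measurable

lemma prof_countable {v1 v2 : ℝ → ℝ} (h1 : Monotone v1) (h2 : Monotone v2) :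
    {s | ¬ ContinuousAt (prof v1 v2) s}.Countable := by
  refine ((h1.countable_not_continuousAt.union h2.countable_not_continuousAt).union
    (countable_singleton (0:ℝ))).mono ?_
  intro s hs
  by_contra hc
  simp only [mem_union, mem_ofPred_eq, mem_singleton_iff, not_or, not_not] at hc
  obtain ⟨⟨c1, c2⟩, h0⟩ := hc
  apply hs
  rcases lt_or_gt_of_ne h0 with h | h
  · refine c1.congr ?_
    filter_upwards [Iio_mem_nhds h] with y hy
    exact (if_pos (show y < 0 from hy)).symm
  · refine c2.congr ?_
    filter_upwards [Ioi_mem_nhds h] with y hy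
    exact (if_neg (not_lt.2 (le_of_lt (show 0 < y from hy)))).symm

lemma riem_meas (a b : ℝ) : Measurable (riem a b) :=
  Measurable.ite measurableSet_Iio measurable_const measurable_const

lemma sol_meas {a b : ℝ} {v : ℝ → ℝ} (hv : Measurable v) :
    Measurable (Function.uncurry (sol a b v)) := by
  refine Measurable.ite (measurableSet_le measurable_fst measurable_const) ?_ ?_
  · exact (riem_meas a b).comp measurable_snd
  · exact hv.comp (measurable_snd.div measurable_fst)

lemma sol_reg {R a b S : ℝ} {v : ℝ → ℝ} (ha : a ∈ Icc 0 R) (hb : b ∈ Icc 0 R)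
    (hv : Measurable v) (hvR : ∀ s, v s ∈ Icc 0 R)
    (hvc : {s | ¬ ContinuousAt v s}.Countable)
    (hSl : ∀ s, s < -S → v s = a) (hSr : ∀ s, S < s → v s = b) : RegSol R (sol a b v) := by
  have hval : ∀ t x, sol a b v t x ∈ Icc (0:ℝ) R := by
    intro t x
    simp only [sol, riem]
    split_ifs
    · exact ha
    · exact hb
    · exact hvR _
  have hsec : ∀ t, Measurable (sol a b v t) := fun t => (sol_meas hv).of_uncurry_left
  refine ⟨sol_meas hv, hval, fun r hr s hs => ?_⟩
  suffices h : Tendsto (fun t => ∫ x in Icc (-r) r, |sol a b v t x - sol a b v s x|)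
      (nhdsWithin s (Ici 0)) (nhds (∫ x in Icc (-r) r, (0:ℝ))) by
    simpa using h
  refine tendsto_integral_filter_of_dominated_convergence (fun _ => R) ?_ ?_ ?_ ?_
  · exact Eventually.of_forall fun t => ((hsec t).sub (hsec s)).abs.aestronglyMeasurable
  · refine Eventually.of_forall fun t => Eventually.of_forall fun x => ?_
    rw [Real.norm_eq_abs, abs_abs, abs_le]
    have h1 := hval t x
    have h2 := hval s x
    constructor <;> linarith [h1.1, h1.2, h2.1, h2.2]
  · simp
  · refine ae_restrict_of_ae ?_
    have hgoal : ∀ x, Tendsto (fun t => sol a b v t x) (nhdsWithin s (Ici 0)) (nhds (sol a b v s x)) →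
        Tendsto (fun t => |sol a b v t x - sol a b v s x|) (nhdsWithin s (Ici 0)) (nhds 0) := by
      intro x hx
      have := (hx.sub_const (sol a b v s x)).abs
      simpa using this
    rcases hs.eq_or_lt with rfl | hs
    · filter_upwards [Measure.ae_ne volume (0:ℝ)] with x hx
      apply hgoal
      refine tendsto_const_nhds.congr' ?_
      have h2 : Tendsto (fun δ : ℝ => δ * S) (nhdsWithin 0 (Ici 0)) (nhds 0) := by
        have := (by fun_prop : Continuous fun δ : ℝ => δ * S).tendsto 0
        rw [zero_mul] at this
        exact this.mono_left nhdsWithin_le_nhds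
      filter_upwards [h2.eventually (gt_mem_nhds (abs_pos.2 hx))] with t h3
      simp only [sol, le_refl, if_true]
      split_ifs with h4
      · rfl
      · push Not at h4
        rcases lt_or_gt_of_ne hx with hx' | hx'
        · rw [abs_of_neg hx'] at h3
          rw [hSl (x / t) (by rw [div_lt_iff₀ h4]; linarith)]
          simp [riem, hx']
        · rw [abs_of_pos hx'] at h3
          rw [hSr (x / t) (by rw [lt_div_iff₀ h4]; linarith)]
          simp [riem, not_lt.2 hx'.le]
    · have hnull : ∀ᵐ x : ℝ, ContinuousAt v (x / s) := by
        have h1 : ((fun x : ℝ => x / s) ⁻¹' {s | ¬ ContinuousAt v s}).Countable :=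
          hvc.preimage (fun x y hxy => by
            simpa [div_left_inj' hs.ne'] using hxy)
        exact h1.measure_zero volume
      filter_upwards [hnull] with x hx
      apply hgoal
      have h1 : Tendsto (fun t => v (x / t)) (nhds s) (nhds (v (x / s))) :=
        hx.tendsto.comp (tendsto_const_nhds.div tendsto_id hs.ne')
      have h2 : sol a b v s x = v (x / s) := by simp [sol, hs]
      rw [h2]
      refine (h1.congr' ?_).mono_left nhdsWithin_le_nhds
      filter_upwards [Ioi_mem_nhds hs] with t ht
      have ht' : 0 < t := ht
      simp [sol, ht']

/-- generic trace estimate -/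
lemma trace_aux {ρ : ℝ → ℝ → ℝ} {γ B : ℝ} {I : ℝ → Set ℝ} {G : ℝ → ℝ}
    (hI : ∀ ε, 0 < ε → volume.real (I ε) = ε) (hIm : ∀ ε, MeasurableSet (I ε))
    (hG : Measurable G) (hGb : ∀ s, |G s| ≤ B)
    (hGl : Tendsto G (nhdsWithin 0 (Ioi 0)) (nhds 0))
    (hρ : ∀ ε t x, 0 < ε → 0 < t → x ∈ I ε → |ρ t x - γ| ≤ G (ε / t))
    {φ : ℝ × ℝ → ℝ} (hφ : TestFn φ) :
    Tendsto (fun ε : ℝ => (1 / ε) * ∫ t in Ioi (0:ℝ), ∫ x in I ε,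
        |ρ t x - γ| * φ (t, x)) (nhdsWithin 0 (Ioi 0)) (nhds 0) := by
  obtain ⟨hc0, hcT, hcX, hdiff, M, C, hM0, hC0, hC, hM⟩ := hφ.bounds
  have hB : 0 ≤ B := (abs_nonneg _).trans (hGb 0)
  set bd : ℝ → ℝ → ℝ := fun ε t => (Ioc 0 M).indicator (fun t => |G (ε / t)| * C) t with hbd
  have hbm : ∀ ε, Measurable (bd ε) := by
    intro ε
    refine Measurable.indicator ?_ measurableSet_Ioc
    exact (hG.comp (measurable_const.div measurable_id)).abs.mul_const C
  have hbb : ∀ ε t, |bd ε t| ≤ (Ioc 0 M).indicator (fun _ => B * C) t := by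
    intro ε t
    simp only [hbd]
    by_cases ht : t ∈ Ioc 0 M
    · rw [indicator_of_mem ht, indicator_of_mem ht, abs_mul, abs_abs, abs_of_nonneg hC0]
      exact mul_le_mul_of_nonneg_right (hGb _) hC0
    · rw [indicator_of_notMem ht, indicator_of_notMem ht]; simp
  have hbi : ∀ ε, Integrable (bd ε) := fun ε =>
    integrable_of_bdd_supp (s := Ioc 0 M) (C := B * C) (hbm ε).aestronglyMeasurable
      measurableSet_Ioc (by simp) (hbb ε)
  have T : Tendsto (fun ε => ∫ t in Ioi (0:ℝ), bd ε t) (nhdsWithin 0 (Ioi 0)) (nhds 0) := by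
    suffices h : Tendsto (fun ε => ∫ t in Ioi (0:ℝ), bd ε t)
        (nhdsWithin 0 (Ioi 0)) (nhds (∫ t in Ioi (0:ℝ), (0:ℝ))) by
      simpa using h
    refine tendsto_integral_filter_of_dominated_convergence
      ((Ioc 0 M).indicator (fun _ => B * C)) ?_ ?_ ?_ ?_
    · exact Eventually.of_forall fun ε => (hbm ε).aestronglyMeasurable
    · exact Eventually.of_forall fun ε => Eventually.of_forall fun t => hbb ε t
    · exact ((integrableOn_const (by simp)).integrable_indicator measurableSet_Ioc).integrableOn
    · filter_upwards [ae_restrict_mem measurableSet_Ioi] with t ht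
      have ht' : 0 < t := ht
      by_cases htM : t ∈ Ioc 0 M
      · simp only [hbd, indicator_of_mem htM]
        have h1 : Tendsto (fun ε : ℝ => ε / t) (nhdsWithin 0 (Ioi 0)) (nhdsWithin 0 (Ioi 0)) := by
          refine tendsto_nhdsWithin_iff.2 ⟨?_, ?_⟩
          · have := (by fun_prop : Continuous fun ε : ℝ => ε / t).tendsto 0
            rw [zero_div] at this
            exact this.mono_left nhdsWithin_le_nhds
          · filter_upwards [self_mem_nhdsWithin] with ε hε
            exact div_pos hε ht'
        have h2 := ((hGl.comp h1).abs).mul_const C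
        simpa using h2
      · simp only [hbd, indicator_of_notMem htM]
        exact tendsto_const_nhds
  refine squeeze_zero_norm' ?_ T
  filter_upwards [self_mem_nhdsWithin] with ε hε
  have hε' : 0 < ε := hε
  rw [← integral_const_mul]
  refine norm_integral_le_of_norm_le (hbi ε).integrableOn ?_
  filter_upwards [ae_restrict_mem measurableSet_Ioi] with t ht
  have ht' : 0 < t := ht
  by_cases htM : t ∈ Ioc 0 M
  · simp only [hbd, indicator_of_mem htM]
    have h1 : ‖∫ x in I ε, |ρ t x - γ| * φ (t, x)‖ ≤ (|G (ε / t)| * C) * volume.real (I ε) := by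
      refine norm_setIntegral_le_of_norm_le_const ?_ fun x hx => ?_
      · have h2 := hI ε hε'
        by_contra h
        have h3 : volume (I ε) = ⊤ := by simpa using h
        rw [Measure.real, h3] at h2
        simp at h2
        linarith
      · rw [norm_mul, Real.norm_eq_abs, abs_abs]
        exact mul_le_mul ((hρ ε t x hε' ht' hx).trans (le_abs_self _)) (hC _).1
          (norm_nonneg _) (abs_nonneg _)
    rw [hI ε hε'] at h1
    rw [norm_mul, Real.norm_eq_abs, abs_of_pos (by positivity)]
    rw [one_div, inv_mul_le_iff₀ hε']
    linarith
  · simp only [hbd, indicator_of_notMem htM]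
    have : M < |t| := by
      by_contra h
      push Not at h
      exact htM ⟨ht', (le_abs_self t).trans h⟩
    have h1 : ∀ x, |ρ t x - γ| * φ (t, x) = 0 := fun x => by
      rw [(hM (t, x) (Or.inl this)).1, mul_zero]
    simp [h1]

lemma sol_left_trace {a b R γ : ℝ} {v1 v2 : ℝ → ℝ} (h1 : Monotone v1) (hR : ∀ s, v1 s ∈ Icc 0 R)
    (hγ : Tendsto v1 (nhdsWithin 0 (Iio 0)) (nhds γ)) :
    LeftTraceAt (sol a b (prof v1 v2)) (fun _ => γ) := by
  intro φ hφ
  have hle : ∀ s, s < 0 → v1 s ≤ γ := by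
    intro s hs
    refine ge_of_tendsto hγ ?_
    filter_upwards [Ioo_mem_nhdsLT hs] with y hy using h1 hy.1.le
  have hγR : γ ∈ Icc 0 R := isClosed_Icc.mem_of_tendsto hγ (Eventually.of_forall hR)
  refine trace_aux (I := fun ε => Ioo (-ε) 0) (G := fun s => γ - v1 (-s)) (B := R) ?_
    (fun ε => measurableSet_Ioo) ?_ ?_ ?_ ?_ hφ
  · intro ε hε; simp [hε.le]
  · exact measurable_const.sub (h1.measurable.comp measurable_neg)
  · intro s
    have := hR (-s)
    rw [abs_le]; constructor <;> linarith [this.1, this.2, hγR.1, hγR.2]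
  · have h2 : Tendsto (fun s : ℝ => -s) (nhdsWithin 0 (Ioi 0)) (nhdsWithin 0 (Iio 0)) := by
      refine tendsto_nhdsWithin_iff.2 ⟨?_, ?_⟩
      · have := (continuous_neg (G := ℝ)).tendsto 0
        rw [neg_zero] at this
        exact this.mono_left nhdsWithin_le_nhds
      · filter_upwards [self_mem_nhdsWithin] with s hs
        exact neg_lt_zero.2 (show 0 < s from hs)
    have := (hγ.comp h2).const_sub γ
    simpa using this
  · intro ε t x hε ht hx
    have hxt : x / t < 0 := div_neg_of_neg_of_pos hx.2 ht
    have e : sol a b (prof v1 v2) t x = v1 (x / t) := by simp [sol, prof, not_le.2 ht, hxt]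
    rw [e, abs_sub_comm, abs_of_nonneg (by linarith [hle _ hxt])]
    have : v1 (-(ε / t)) ≤ v1 (x / t) := by
      apply h1
      rw [← neg_div]
      gcongr
      exact hx.1.le
    linarith

lemma sol_right_trace {a b R γ : ℝ} {v1 v2 : ℝ → ℝ} (h1 : Monotone v2) (hR : ∀ s, v2 s ∈ Icc 0 R)
    (hγ : Tendsto v2 (nhdsWithin 0 (Ioi 0)) (nhds γ)) :
    RightTraceAt (sol a b (prof v1 v2)) (fun _ => γ) := by
  intro φ hφ
  have hle : ∀ s, 0 < s → γ ≤ v2 s := by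
    intro s hs
    refine le_of_tendsto hγ ?_
    filter_upwards [Ioo_mem_nhdsGT hs] with y hy using h1 hy.2.le
  have hγR : γ ∈ Icc 0 R := isClosed_Icc.mem_of_tendsto hγ (Eventually.of_forall hR)
  refine trace_aux (I := fun ε => Ioo 0 ε) (G := fun s => v2 s - γ) (B := R) ?_
    (fun ε => measurableSet_Ioo) ?_ ?_ ?_ ?_ hφ
  · intro ε hε; simp [hε.le]
  · exact h1.measurable.sub_const γ
  · intro s
    have := hR s
    rw [abs_le]; constructor <;> linarith [this.1, this.2, hγR.1, hγR.2]
  · have := hγ.sub_const γ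
    simpa using this
  · intro ε t x hε ht hx
    have hxt : 0 < x / t := div_pos hx.1 ht
    have e : sol a b (prof v1 v2) t x = v2 (x / t) := by
      simp [sol, prof, not_le.2 ht, not_lt.2 hxt.le]
    rw [e, abs_of_nonneg (by linarith [hle _ hxt])]
    have : v2 (x / t) ≤ v2 (ε / t) := by
      apply h1
      gcongr
      exact hx.2.le
    linarith

lemma master {R ρb : ℝ} {f : ℝ → ℝ} (hF : AF R ρb f) {L : NNReal}
    (hLip : LipschitzOnWith L f (Icc 0 R)) {a1 b1 a2 b2 q : ℝ} {v1 v2 : ℝ → ℝ}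
    (ha1 : 0 ≤ a1) (hab1 : a1 ≤ b1) (hb1 : b1 ≤ R) (ha2 : 0 ≤ a2) (hab2 : a2 ≤ b2) (hb2 : b2 ≤ R)
    (h1 : Sel f a1 b1 v1) (h2 : Sel f a2 b2 v2)
    (hq1 : ∀ r ∈ Icc a1 b1, q ≤ f r) (hq1' : ∃ r ∈ Icc a1 b1, f r = q)
    (hq2 : ∀ r ∈ Icc a2 b2, q ≤ f r) (hq2' : ∃ r ∈ Icc a2 b2, f r = q) :
    ∃ γm γp, f γm = q ∧ f γp = q ∧ γm ∈ Icc a1 b1 ∧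
      Tendsto v1 (nhdsWithin 0 (Iio 0)) (nhds γm) ∧
      ∀ T, CEIOn R (f ρb) T f (fun _ => q) (riem a1 b2) (sol a1 b2 (prof v1 v2))
        (fun _ => γm) (fun _ => γp) := by
  have hs1 : Icc a1 b1 ⊆ Icc 0 R := Icc_subset_Icc ha1 hb1
  have hs2 : Icc a2 b2 ⊆ Icc 0 R := Icc_subset_Icc ha2 hb2
  have hc1 := hF.cont.mono hs1
  have hc2 := hF.cont.mono hs2
  have hm1 := h1.mono
  have hm2 := h2.mono
  have t1 := hm1.tendsto_leftLim 0
  have t2 := hm2.tendsto_rightLim 0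
  obtain ⟨hγm, hfm⟩ := h1.lim hc1 hq1 hq1' nhdsWithin_le_nhds t1
  obtain ⟨hγp, hfp⟩ := h2.lim hc2 hq2 hq2' nhdsWithin_le_nhds t2
  have e1 := (h1.lim hc1 hq1 hq1' (l := pure 0) (pure_le_nhds 0) (tendsto_pure_nhds v1 0)).2
  have e2 := (h2.lim hc2 hq2 hq2' (l := pure 0) (pure_le_nhds 0) (tendsto_pure_nhds v2 0)).2
  have r1 : ∀ s, v1 s ∈ Icc 0 R := fun s => hs1 (h1 s).1
  have r2 : ∀ s, v2 s ∈ Icc 0 R := fun s => hs2 (h2 s).1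
  have r : ∀ s, prof v1 v2 s ∈ Icc 0 R := by
    intro s; unfold prof; split_ifs
    exacts [r1 s, r2 s]
  have p1 : ∀ {s}, s < 0 → prof v1 v2 s = v1 s := fun hs => if_pos hs
  have p2 : ∀ {s}, 0 ≤ s → prof v1 v2 s = v2 s := fun hs => if_neg (not_lt.2 hs)
  have hSl : ∀ s, s < -(L:ℝ) → prof v1 v2 s = a1 := fun s hs => by
    rw [p1 (hs.trans_le (neg_nonpos.2 L.coe_nonneg))]
    exact h1.left (hLip.mono hs1) hab1 hs
  have hSr : ∀ s, (L:ℝ) < s → prof v1 v2 s = b2 := fun s hs => by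
    rw [p2 (L.coe_nonneg.trans hs.le)]
    exact h2.right (hLip.mono hs2) hab2 hs
  have hq0 : 0 ≤ q := hfm ▸ hF.2.2.1 _ (hs1 hγm)
  have hqm : q ≤ f ρb := hfm ▸ hF.le_max (hs1 hγm)
  have hcount := prof_countable hm1 hm2
  refine ⟨_, _, hfm, hfp, hγm, t1, fun T => ⟨?_, fun _ => ⟨hq0, hqm⟩, ?_,
    sol_left_trace hm1 r1 t1, sol_right_trace hm2 r2 t2, ?_⟩⟩
  · exact sol_reg (hs1 ⟨le_rfl, hab1⟩) (hs2 ⟨hab2, le_rfl⟩) (prof_meas hm1 hm2) r hcount hSl hSr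
  · intro φ hφ hφ0 _ k hk
    obtain ⟨g, hg, hgf⟩ := hLip.extend_real
    have hk0 : 0 ≤ f k := hF.2.2.1 k hk
    have hd : q / f ρb ≤ 1 := div_le_one_of_le₀ hqm (hq0.trans hqm)
    have hc : 0 ≤ 2 * ((1 - q / f ρb) * f k) :=
      mul_nonneg zero_le_two (mul_nonneg (by linarith) hk0)
    have key := twoD (v := prof v1 v2)
      (Ψ := fun s => Real.sign (prof v1 v2 s - k) * (f (prof v1 v2 s) - f k)) (k := k)
      (c := 2 * ((1 - q / f ρb) * f k)) (A := f ρb) (B := R) (S := L) (uL := a1) (uR := b2)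
      (φ := φ) hc (prof_meas hm1 hm2) ?_ ?_ ?_ ?_ ?_ ?_ hSl hSr hφ hφ0
    · have i1 : (∫ t in Ioi (0:ℝ), ∫ x : ℝ,
          (|sol a1 b2 (prof v1 v2) t x - k| * pdT φ (t, x) +
            Real.sign (sol a1 b2 (prof v1 v2) t x - k) * (f (sol a1 b2 (prof v1 v2) t x) - f k)
              * pdX φ (t, x))) =
          ∫ t in Ioi 0, ∫ x, (|prof v1 v2 (x/t)-k| * pdT φ (t,x) +
            Real.sign (prof v1 v2 (x/t) - k) * (f (prof v1 v2 (x/t)) - f k)  * pdX φ (t,x)) := by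
        refine setIntegral_congr_fun measurableSet_Ioi fun t ht => ?_
        have ht' : ¬ t ≤ 0 := not_le.2 ht
        simp only [sol, if_neg ht']
      have i2 : (2 * ∫ t in Ioi (0:ℝ), (1 - q / f ρb) * f k * φ (t, 0)) =
          2 * ((1 - q / f ρb) * f k) * ∫ t in Ioi (0:ℝ), φ (t, 0) := by
        rw [integral_const_mul]; ring
      rw [i1, i2]
      exact key
    · intro s
      have := r s
      rw [abs_le]; constructor <;> linarith [this.1, this.2, hk.1, hk.2]
    · exact hcount.ae_notMem volume |>.mono fun s hs => by simpa using hs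
    · have : (fun s => Real.sign (prof v1 v2 s - k) * (f (prof v1 v2 s) - f k)) =
          fun s => Real.sign (prof v1 v2 s - k) * (g (prof v1 v2 s) - f k) := by
        funext s; rw [hgf (r s)]
      rw [this]
      exact (measurable_sign'.comp ((prof_meas hm1 hm2).sub_const k)).mul
        ((hg.continuous.measurable.comp (prof_meas hm1 hm2)).sub_const _)
    · intro s
      have a0 := hF.2.2.1 _ (r s)
      have a1 := hF.le_max (r s)
      have a2 := hF.le_max hk
      have : |f (prof v1 v2 s) - f k| ≤ f ρb := by rw [abs_le]; constructor <;> linarith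
      rw [abs_mul]
      refine (mul_le_of_le_one_left (abs_nonneg _) ?_).trans this
      rcases Real.sign_apply_eq (prof v1 v2 s - k) with h | h | h <;> rw [h] <;> norm_num
    · rintro s t hst (h | h)
      · simp only [p1 h, p1 (hst.trans_lt h)]
        exact h1.ent k s t hst
      · simp only [p2 h, p2 (h.trans hst)]
        exact h2.ent k s t hst
    · intro s t hs ht
      simp only [p1 hs, p2 ht]
      have u1 := h1.ent k s 0 hs.le
      have u2 := h2.ent k 0 t ht
      have u3 := hF.jump (r1 0) (r2 0) hk e1 e2
      have n1 : 0 ≤ (0 - s) * (max 0 (v1 s - k) + max 0 (k - v1 0)) :=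
        mul_nonneg (by linarith) (add_nonneg (le_max_left _ _) (le_max_left _ _))
      have n2 : 0 ≤ (t - 0) * (max 0 (v2 0 - k) + max 0 (k - v2 t)) :=
        mul_nonneg (by linarith) (add_nonneg (le_max_left _ _) (le_max_left _ _))
      linarith
  · exact Eventually.of_forall fun _ => ⟨hfm.le, hfp.le⟩

lemma pplus_attained {R fmax : ℝ} {p : ℝ → ℝ} (hP : AP2 R fmax p) {a : ℝ} (ha : 0 ≤ a)
    (haR : a < R) : ∃ y ∈ Ioc a R, ∀ ξ ∈ Ioc a y, p ξ = pplus R p a := by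
  have hsub : Ioc a R ⊆ Icc 0 R := fun x hx => ⟨ha.trans hx.1.le, hx.2⟩
  have hfin : (p '' Ioc a R).Finite := hP.2.2.subset (image_mono hsub)
  have hne : (p '' Ioc a R).Nonempty := ⟨_, R, ⟨haR, le_rfl⟩, rfl⟩
  obtain ⟨y, hy, hpy⟩ := hne.csSup_mem hfin
  have e : pplus R p a = sSup (p '' Ioc a R) := if_neg (not_le.2 haR)
  refine ⟨y, hy, fun ξ hξ => ?_⟩
  have hξ' : ξ ∈ Ioc a R := ⟨hξ.1, hξ.2.trans hy.2⟩
  rw [e]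
  refine le_antisymm (le_csSup hfin.bddAbove ⟨ξ, hξ', rfl⟩) ?_
  rw [← hpy]
  exact hP.1 (hsub hξ') (hsub hy) hξ.2

lemma p_mem {R fmax : ℝ} {p : ℝ → ℝ} (hP : AP2 R fmax p) {ξ : ℝ} (h0 : 0 < ξ) (hR : ξ < R) :
    p ξ ∈ Icc (pplus R p ξ) (pminus p ξ) := by
  have hξ : ξ ∈ Icc 0 R := ⟨h0.le, hR.le⟩
  rw [pplus, pminus, if_neg (not_le.2 hR), if_neg (not_le.2 h0)]
  constructor
  · refine csSup_le ⟨_, R, ⟨hR, le_rfl⟩, rfl⟩ ?_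
    rintro _ ⟨y, hy, rfl⟩
    exact hP.1 hξ ⟨h0.le.trans hy.1.le, hy.2⟩ hy.1.le
  · refine le_csInf ⟨_, 0, ⟨le_rfl, h0⟩, rfl⟩ ?_
    rintro _ ⟨y, hy, rfl⟩
    exact hP.1 ⟨hy.1, hy.2.le.trans hR.le⟩ hξ hy.2.le

lemma AW.integrable {w : ℝ → ℝ} (hW : AW w) : IntegrableOn w (Iic 0) := by
  by_contra h
  have := hW.2.2.1
  rw [integral_undef h] at this
  norm_num at this

lemma ae_neg : ∀ᵐ x ∂(volume.restrict (Iic (0:ℝ))), x < 0 := by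
  rw [ae_restrict_iff' measurableSet_Iic]
  filter_upwards [Measure.ae_ne volume (0:ℝ)] with x hx hx'
  exact lt_of_le_of_ne hx' hx

lemma AW.exists_pos {w : ℝ → ℝ} (hW : AW w) : ∃ x0 < 0, ∀ x ∈ Icc x0 0, 0 < w x := by
  by_contra! h
  have : ∀ x < 0, w x = 0 := by
    intro x hx
    obtain ⟨y, hy, hy'⟩ := h x hx
    exact le_antisymm ((hW.2.1 hx.le hy.2 hy.1).trans hy') (hW.1 x hx.le)
  have h0 : (∫ x in Iic (0:ℝ), w x) = ∫ x in Iic (0:ℝ), (0:ℝ) := by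
    refine integral_congr_ae ?_
    filter_upwards [ae_neg] with x hx using this x hx
  have := hW.2.2.1
  rw [h0] at this
  simp at this

lemma AW.mul_int {w u : ℝ → ℝ} {R : ℝ} (hW : AW w) (hu : Measurable u)
    (hb : ∀ x, u x ∈ Icc 0 R) : IntegrableOn (fun x => w x * u x) (Iic 0) :=
  Integrable.mul_bdd (c := R) hW.integrable hu.aestronglyMeasurable
    (Eventually.of_forall fun x => by rw [Real.norm_eq_abs, abs_of_nonneg (hb x).1]; exact (hb x).2)

lemma AW.sub_eq {w u : ℝ → ℝ} {R a : ℝ} (hW : AW w) (hu : Measurable u)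
    (hb : ∀ x, u x ∈ Icc 0 R) :
    (∫ x in Iic (0:ℝ), w x * (u x - a)) = (∫ x in Iic (0:ℝ), w x * u x) - a := by
  have : ∀ x, w x * (u x - a) = w x * u x - w x * a := fun x => mul_sub _ _ _
  simp_rw [this]
  rw [integral_sub (hW.mul_int hu hb) (hW.integrable.mul_const a), integral_mul_const,
    hW.2.2.1, one_mul]

lemma AW.lower {w u : ℝ → ℝ} {R a d : ℝ} (hW : AW w) (hu : Measurable u)
    (hb : ∀ x, u x ∈ Icc 0 R) (hd : 0 < d) (h1 : ∀ x < 0, a ≤ u x)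
    (h2 : ∀ x ∈ Ioo (-d) 0, a < u x) : a < ∫ x in Iic (0:ℝ), w x * u x := by
  rw [← sub_pos, ← hW.sub_eq hu hb]
  obtain ⟨x0, hx0, hw⟩ := hW.exists_pos
  have hi : IntegrableOn (fun x => w x * (u x - a)) (Iic 0) := by
    have : (fun x => w x * (u x - a)) = fun x => w x * u x - w x * a := by
      funext x; ring
    rw [this]
    exact (hW.mul_int hu hb).sub (hW.integrable.mul_const a)
  have hnn : 0 ≤ᵐ[volume.restrict (Iic (0:ℝ))] fun x => w x * (u x - a) := by
    filter_upwards [ae_neg] with x hx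
    exact mul_nonneg (hW.1 x hx.le) (sub_nonneg.2 (h1 x hx))
  rw [setIntegral_pos_iff_support_of_nonneg_ae hnn hi]
  have hm : max x0 (-d) < 0 := max_lt hx0 (by linarith)
  have hsub : Ioo (max x0 (-d)) 0 ⊆ Function.support (fun x => w x * (u x - a)) ∩ Iic 0 := by
    intro x hx
    have q1 := (le_max_left _ _).trans_lt hx.1
    have q2 := (le_max_right _ _).trans_lt hx.1
    refine ⟨?_, hx.2.le⟩
    exact (mul_pos (hw x ⟨q1.le, hx.2.le⟩) (sub_pos.2 (h2 x ⟨q2, hx.2⟩))).ne'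
  refine lt_of_lt_of_le ?_ (measure_mono hsub)
  rw [Real.volume_Ioo]
  simpa using hm

lemma AW.upper {w u : ℝ → ℝ} {R a m : ℝ} (hW : AW w) (hu : Measurable u)
    (hb : ∀ x, u x ∈ Icc 0 R) (ha : 0 ≤ a) (hm : 0 ≤ m) (h1 : ∀ x < -m, u x = a) :
    (∫ x in Iic (0:ℝ), w x * u x) ≤ a + w 0 * R * m := by
  have hR : 0 ≤ R := (hb 0).1.trans (hb 0).2
  have hw0 : 0 ≤ w 0 := hW.1 0 le_rfl
  have key : (∫ x in Iic (0:ℝ), w x * (u x - a)) ≤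
      ∫ x in Iic (0:ℝ), (Icc (-m) 0).indicator (fun _ => w 0 * R) x := by
    refine setIntegral_mono_on ?_ ?_ measurableSet_Iic ?_
    · have : (fun x => w x * (u x - a)) = fun x => w x * u x - w x * a := by
        funext x; ring
      rw [this]
      exact (hW.mul_int hu hb).sub (hW.integrable.mul_const a)
    · refine (IntegrableOn.integrable_indicator ?_ measurableSet_Icc).integrableOn
      exact integrableOn_const (by simp)
    · intro x hx
      by_cases hxm : x < -m
      · rw [h1 x hxm, sub_self, mul_zero]
        exact indicator_nonneg (fun _ _ => mul_nonneg hw0 hR) x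
      · have hmem : x ∈ Icc (-m) 0 := ⟨not_lt.1 hxm, hx⟩
        rw [indicator_of_mem hmem]
        have hwx : w x ≤ w 0 := hW.2.1 hx (mem_Iic.2 le_rfl) hx
        have hwx0 := hW.1 x hx
        have := (hb x).2
        exact (mul_le_mul_of_nonneg_left (by linarith) hwx0).trans
          (mul_le_mul_of_nonneg_right hwx hR)
  have hsub : Icc (-m) 0 ⊆ Iic (0:ℝ) := fun x hx => hx.2
  rw [hW.sub_eq hu hb, setIntegral_indicator measurableSet_Icc,
    inter_eq_self_of_subset_right hsub] at key
  simp [hm] at key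
  linarith [mul_comm m (w 0 * R)]

lemma AF.level {R ρb : ℝ} {f : ℝ → ℝ} (hF : AF R ρb f) {q : ℝ} (h0 : 0 ≤ q) (hq : q ≤ f ρb) :
    (∃ x ∈ Icc 0 ρb, f x = q) ∧ ∃ x ∈ Icc ρb R, f x = q := by
  have hρ := hF.2.2.2.2.2.1
  constructor
  · have := intermediate_value_Icc hρ.1.le (hF.cont.mono (Icc_subset_Icc_right hρ.2.le))
    exact this ⟨by rw [hF.2.2.2.1]; exact h0, hq⟩
  · have := intermediate_value_Icc' hρ.2.le (hF.cont.mono (Icc_subset_Icc_left hρ.1.le))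
    exact this ⟨by rw [hF.2.2.2.2.1]; exact h0, hq⟩

lemma not_aeEq {τ δ : ℝ} {ρ1 ρ2 : ℝ → ℝ → ℝ} (hτ : 0 < τ) (hδ : 0 < δ)
    (h : ∀ t > 0, ∀ x < 0, -δ < x / t → ρ1 t x ≠ ρ2 t x) : ¬ aeEqOn τ ρ1 ρ2 := by
  intro hae
  have hB : (volume : Measure (ℝ × ℝ)) (Ioo (τ/2) τ ×ˢ Ioo (-(δ*τ/2)) 0) = 0 := by
    have h0 := (ae_restrict_iff' (measurableSet_Ioo.prod MeasurableSet.univ)).1 hae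
    refine measure_mono_null ?_ h0
    rintro ⟨t, x⟩ ⟨ht, hx⟩ hc
    have ht0 : 0 < t := lt_trans (half_pos hτ) ht.1
    refine h t ht0 x hx.2 ?_ (hc ⟨⟨ht0, ht.2⟩, mem_univ _⟩)
    rw [lt_div_iff₀ ht0]
    have := hx.1
    have := ht.1
    simp only at *
    nlinarith
  rw [Measure.volume_eq_prod, Measure.prod_prod, mul_eq_zero, Real.volume_Ioo, Real.volume_Ioo,
    ENNReal.ofReal_eq_zero, ENNReal.ofReal_eq_zero] at hB
  have := mul_pos hδ hτ
  rcases hB with h | h <;> linarith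

/-- in case (CN2) the constrained Riemann problem admits (locally in time)
two distinct entropy weak solutions, one with boundary flux `f ρL` (classical) and one
with boundary flux `p(ρL+)` (nonclassical). -/
theorem stmt8 (R ρb : ℝ) (f w p : ℝ → ℝ) (hF : AF R ρb f) (hW : AW w)
    (hP : AP2 R (f ρb) p) (ρL ρR : ℝ) (hL : ρL ∈ Icc (0:ℝ) R) (hR' : ρR ∈ Icc (0:ℝ) R)
    (h1 : ρL < ρR) (h2 : f ρL ≤ f ρR)
    (h3 : pplus R p ρL < f ρL) (h4 : f ρL ≤ pminus p ρL) :
    ∃ T > (0:ℝ), ∃ ρ1 ρ2 : ℝ → ℝ → ℝ, ∃ γm1 γp1 γm2 γp2 : ℝ → ℝ,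
      EWSolOn R (f ρb) T f w p (riem ρL ρR) ρ1 γm1 γp1 ∧
      EWSolOn R (f ρb) T f w p (riem ρL ρR) ρ2 γm2 γp2 ∧
      (∀ᵐ t ∂(volume.restrict (Ioo (0:ℝ) T)), f (γm1 t) = f ρL ∧ f (γp1 t) = f ρL) ∧
      (∀ᵐ t ∂(volume.restrict (Ioo (0:ℝ) T)),
        f (γm2 t) = pplus R p ρL ∧ f (γp2 t) = pplus R p ρL) ∧
      ∀ τ ∈ Ioc (0:ℝ) T, ¬ aeEqOn τ ρ1 ρ2 := by
  obtain ⟨L, hLip⟩ := hF.2.1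
  have hρ := hF.2.2.2.2.2.1
  have hLR : ρL < R := h1.trans_le hR'.2
  -- first solution
  obtain ⟨v1, hv1⟩ := exists_sel (le_refl ρL) (hF.cont.mono (Icc_subset_Icc hL.1 hL.2))
  obtain ⟨v2, hv2⟩ := exists_sel h1.le (hF.cont.mono (Icc_subset_Icc hL.1 hR'.2))
  have hmin : ∀ r ∈ Icc ρL ρR, f ρL ≤ f r := fun r hr => by
    have := hF.quasi hL.1 hR'.2 hr.1 hr.2
    rwa [min_eq_left h2] at this
  obtain ⟨γm1, γp1, e1, e1', -, -, S1⟩ := master hF hLip hL.1 le_rfl hL.2 hL.1 h1.le hR'.2 hv1 hv2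
    (q := f ρL) (fun r hr => (congrArg f (le_antisymm hr.1 hr.2)).le)
    ⟨ρL, ⟨le_rfl, le_rfl⟩, rfl⟩ hmin ⟨ρL, ⟨le_rfl, h1.le⟩, rfl⟩
  have hsol1 : ∀ t > 0, ∀ x < 0, sol ρL ρR (prof v1 v2) t x = ρL := by
    intro t ht x hx
    have h := div_neg_of_neg_of_pos hx ht
    rw [sol, if_neg (not_le.2 ht), prof, if_pos h]
    exact le_antisymm (hv1 _).1.2 (hv1 _).1.1
  have havg1 : ∀ t > 0, wAvg w (sol ρL ρR (prof v1 v2)) t = ρL := by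
    intro t ht
    have : wAvg w (sol ρL ρR (prof v1 v2)) t = ∫ x in Iic (0:ℝ), w x * ρL := by
      refine integral_congr_ae ?_
      filter_upwards [ae_neg] with x hx
      rw [hsol1 t ht x hx]
    rw [this, integral_mul_const, hW.2.2.1, one_mul]
  -- second solution
  obtain ⟨y, hy, hpy⟩ := pplus_attained hP hL.1 hLR
  set q := pplus R p ρL with hqdef
  have hyq : p y = q := hpy y ⟨hy.1, le_rfl⟩
  have hyI : y ∈ Icc 0 R := ⟨hL.1.trans hy.1.le, hy.2⟩
  have hq0 : 0 < q := hyq ▸ (hP.2.1 y hyI).1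
  have hqm : q ≤ f ρb := hyq ▸ (hP.2.1 y hyI).2
  obtain ⟨⟨rc, hrc, frc⟩, ⟨rh, hrh, frh⟩⟩ := hF.level hq0.le hqm
  have hcL : rc < ρL := by
    by_contra hc
    have hc := not_lt.1 hc
    have := hF.strictMono.monotoneOn ⟨hL.1, hc.trans hrc.2⟩ hrc hc
    linarith
  have hLh : ρL < rh := by
    by_contra hc
    have hc := not_lt.1 hc
    have := hF.strictAnti.antitoneOn hrh ⟨hrh.1.trans hc, hL.2⟩ hc
    linarith
  obtain ⟨u1, hu1⟩ := exists_sel hLh.le (hF.cont.mono (Icc_subset_Icc hL.1 hrh.2))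
  obtain ⟨u2, hu2⟩ := exists_sel (hcL.trans h1).le (hF.cont.mono (Icc_subset_Icc hrc.1 hR'.2))
  obtain ⟨γm2, γp2, e2, e2', hγI, hγ, S2⟩ := master hF hLip hL.1 hLh.le hrh.2 hrc.1
    (hcL.trans h1).le hR'.2 hu1 hu2 (q := q)
    (fun r hr => by
      have := hF.quasi hL.1 hrh.2 hr.1 hr.2
      rwa [min_eq_right (by linarith), frh] at this)
    ⟨rh, ⟨hLh.le, le_rfl⟩, frh⟩
    (fun r hr => by
      have := hF.quasi hrc.1 hR'.2 hr.1 hr.2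
      rwa [min_eq_left (by linarith), frc] at this)
    ⟨rc, ⟨le_rfl, (hcL.trans h1).le⟩, frc⟩
  have hγL : ρL < γm2 := by
    refine lt_of_le_of_ne hγI.1 fun h => ?_
    rw [← h] at e2
    linarith
  obtain ⟨δ, hδ, hδu⟩ : ∃ δ > 0, ∀ s, -δ < s → s < 0 → ρL < u1 s := by
    have := hγ.eventually (lt_mem_nhds hγL)
    obtain ⟨l, hl, hl'⟩ := (mem_nhdsLT_iff_exists_Ioo_subset (a := (0:ℝ))).1 this
    have hl0 : l < 0 := hl
    exact ⟨-l, by linarith, fun s h1 h2 => hl' ⟨by linarith, h2⟩⟩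
  have hsol2 : ∀ t > 0, ∀ x < 0, sol ρL ρR (prof u1 u2) t x = u1 (x / t) := by
    intro t ht x hx
    have h := div_neg_of_neg_of_pos hx ht
    rw [sol, if_neg (not_le.2 ht), prof, if_pos h]
  have hreg := (S2 1).1
  have hmeas : ∀ t, Measurable (sol ρL ρR (prof u1 u2) t) := fun t => hreg.1.of_uncurry_left
  have hlow : ∀ t > 0, ρL < wAvg w (sol ρL ρR (prof u1 u2)) t := by
    intro t ht
    refine hW.lower (R := R) (d := δ * t) (hmeas t) (hreg.2.1 t) (by positivity) ?_ ?_
    · intro x hx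
      rw [hsol2 t ht x hx]
      exact (hu1 _).1.1
    · intro x hx
      rw [hsol2 t ht x hx.2]
      refine hδu _ ?_ (div_neg_of_neg_of_pos hx.2 ht)
      rw [lt_div_iff₀ ht]
      linarith [hx.1]
  have hup : ∀ t > 0, wAvg w (sol ρL ρR (prof u1 u2)) t ≤ ρL + w 0 * R * ((L + 1) * t) := by
    intro t ht
    have hLn : (0:ℝ) ≤ L := L.coe_nonneg
    refine hW.upper (hmeas t) (hreg.2.1 t) hL.1 (by positivity) ?_
    intro x hx
    have hx0 : x < 0 := hx.trans_le (neg_nonpos.2 (by positivity))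
    rw [hsol2 t ht x hx0]
    refine hu1.left (hLip.mono (Icc_subset_Icc hL.1 hrh.2)) hLh.le ?_
    rw [div_lt_iff₀ ht]
    nlinarith
  have hC : 0 ≤ w 0 * R * (L + 1) :=
    mul_nonneg (mul_nonneg (hW.1 0 le_rfl) hF.1.le) (by positivity)
  set C := w 0 * R * (L + 1) with hCdef
  have hT : 0 < (y - ρL) / (C + 1) := div_pos (sub_pos.2 hy.1) (by linarith)
  refine ⟨(y - ρL) / (C + 1), hT, sol ρL ρR (prof v1 v2), sol ρL ρR (prof u1 u2),
    fun _ => γm1, fun _ => γp1, fun _ => γm2, fun _ => γp2, ⟨fun _ => f ρL, S1 _, ?_⟩,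
    ⟨fun _ => q, S2 _, ?_⟩, Eventually.of_forall fun _ => ⟨e1, e1'⟩,
    Eventually.of_forall fun _ => ⟨e2, e2'⟩, ?_⟩
  · rw [ae_restrict_iff' measurableSet_Ioo]
    refine Eventually.of_forall fun t ht => ?_
    rw [havg1 t ht.1]
    exact ⟨h3.le, h4⟩
  · rw [ae_restrict_iff' measurableSet_Ioo]
    refine Eventually.of_forall fun t ht => ?_
    have hl := hlow t ht.1
    have hu := hup t ht.1
    have htT : t * (C + 1) < y - ρL := (lt_div_iff₀ (by linarith)).1 ht.2
    have ht0 : 0 < t := ht.1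
    have hlt : wAvg w (sol ρL ρR (prof u1 u2)) t < y := by
      have : w 0 * R * ((L + 1) * t) = t * C := by rw [hCdef]; ring
      linarith
    have := p_mem hP (hL.1.trans_lt hl) (hlt.trans_le hy.2)
    rwa [hpy _ ⟨hl, hlt.le⟩] at this
  · intro τ hτ
    refine not_aeEq hτ.1 hδ fun t ht x hx hs => ?_
    rw [hsol1 t ht x hx, hsol2 t ht x hx]
    exact (hδu _ hs (div_neg_of_neg_of_pos hx ht)).ne

end

end CRP
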